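/- (Theorem 6: geometric limit of K.) Under the setup below, with ρ < 1, δ < 1 and α + β > 1, for every fixed integer k ≥ 0: lim_{n→∞} P_n({(k,i₁,i₂) : all i₁,i₂}) = (1 − (1−β)/α) · ((1−β)/α)^k. In particular K converges in distribution to a geometric random variable on {0,1,2,...} with success probability 1 − (1−β)/α. -/

import Mathlib

open Filter

/-- Number of pool-1 (flexible) servers for system size `n`. -/
noncomputable def Npool1 (θ : ℝ) (n : ℕ) : ℕ := ⌈θ * n⌉₊

/-- Number of pool-2 servers for system size `n`. -/
noncomputable def Npool2 (θ : ℝ) (n : ℕ) : ℕ := n - Npool1 θ n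

/-- Total arrival rate for system size `n`. -/
noncomputable def Nlam (μ₁ μ₂ θ ρ : ℝ) (n : ℕ) : ℝ :=
  ρ * ((Npool1 θ n : ℝ) * μ₁ + (Npool2 θ n : ℝ) * μ₂)

/-- Unnormalized stationary weight `w_n(k, i₁, i₂)` of the FCFS-ALIS
many-server N-system, where `k` is the number of pool-2 servers following the
last pool-1 server among the idle servers and `i₁`, `i₂` are the numbers of
idle pool-1, pool-2 servers. -/
noncomputable def Nwt (μ₁ μ₂ θ ρ α : ℝ) (n : ℕ) : ℕ × ℕ × ℕ → ℝ := fun t =>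
  let k := t.1
  let i₁ := t.2.1
  let i₂ := t.2.2
  let n₁ := Npool1 θ n
  let n₂ := Npool2 θ n
  let lam := Nlam μ₁ μ₂ θ ρ n
  let lam₁ := α * lam
  let lam₂ := (1 - α) * lam
  if k ≤ n₂ ∧ 1 ≤ i₁ ∧ i₁ ≤ n₁ ∧ k ≤ i₂ ∧ i₂ ≤ n₂ then
    (n₁.choose i₁ : ℝ) * (n₂.choose i₂ : ℝ) * (i₁ : ℝ) *
      ((i₁ + i₂ - k - 1).factorial : ℝ) * ((i₂.factorial : ℝ) / ((i₂ - k).factorial : ℝ)) *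
      μ₁ ^ i₁ * μ₂ ^ i₂ * (lam ^ (i₁ + i₂))⁻¹ * (lam / lam₁) ^ k
  else if 1 ≤ k ∧ k ≤ n₂ ∧ i₁ = 0 ∧ 1 ≤ i₂ ∧ i₂ ≤ k then
    (n₁ : ℝ) * ((n₂.factorial : ℝ) / ((n₂ - k).factorial : ℝ)) * μ₁ * μ₂ ^ k *
      (lam₁ ^ i₂)⁻¹ *
      ∏ j ∈ Finset.Icc (n - k) (n - i₂), (μ₁ * (n₁ : ℝ) + μ₂ * ((j : ℝ) - (n₁ : ℝ)) - lam₂)⁻¹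
  else if k ≤ n₂ ∧ i₁ = 0 ∧ i₂ = 0 then
    (n₁ : ℝ) * ((n₂.factorial : ℝ) / ((n₂ - k).factorial : ℝ)) * μ₁ * μ₂ ^ k *
      (μ₁ * (n₁ : ℝ) + μ₂ * (n₂ : ℝ) - lam)⁻¹ *
      ∏ j ∈ Finset.Icc (n - k) (n - 1), (μ₁ * (n₁ : ℝ) + μ₂ * ((j : ℝ) - (n₁ : ℝ)) - lam₂)⁻¹
  else 0

/-- Stationary probability of the event `E` of triples `(k, i₁, i₂)` for the
FCFS-ALIS many-server N-system of size `n`. -/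
noncomputable def NP (μ₁ μ₂ θ ρ α : ℝ) (n : ℕ) (E : Set (ℕ × ℕ × ℕ)) : ℝ :=
  (∑' t : E, Nwt μ₁ μ₂ θ ρ α n t) / (∑' t : ℕ × ℕ × ℕ, Nwt μ₁ μ₂ θ ρ α n t)

section Density

open MeasureTheory Set

/-- The unnormalised density `e^{-λs}(1+μ₁s)^N(1+μ₂s)^M`. -/
noncomputable def ndens (μ₁ μ₂ lam : ℝ) (N M : ℕ) (s : ℝ) : ℝ :=
  Real.exp (-(lam * s)) * (1 + μ₁ * s) ^ N * (1 + μ₂ * s) ^ M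

/-- The integral of `f` over `(0, ∞)` against the density `ndens`. -/
noncomputable def nmom (μ₁ μ₂ lam : ℝ) (N M : ℕ) (f : ℝ → ℝ) : ℝ :=
  ∫ s in Ioi (0 : ℝ), f s * ndens μ₁ μ₂ lam N M s

lemma integrableOn_pow_mul_exp {lam : ℝ} (hl : 0 < lam) (j : ℕ) :
    IntegrableOn (fun s : ℝ => s ^ j * Real.exp (-(lam * s))) (Ioi 0) := by
  have h := integrableOn_rpow_mul_exp_neg_mul_rpow (p := 1) (s := (j : ℝ)) (b := lam)
    (by have : (0 : ℝ) ≤ j := j.cast_nonneg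
        linarith) one_pos hl
  simpa using h

lemma integral_pow_mul_exp {lam : ℝ} (hl : 0 < lam) (j : ℕ) :
    ∫ s in Ioi (0 : ℝ), s ^ j * Real.exp (-(lam * s)) = j.factorial / lam ^ (j + 1) := by
  have h := Real.integral_rpow_mul_exp_neg_mul_Ioi (a := (j : ℝ) + 1) (r := lam)
    (by positivity) hl
  rw [Real.Gamma_nat_eq_factorial] at h
  have e : (1 / lam) ^ ((j : ℝ) + 1) = (1 / lam) ^ (j + 1) := by
    rw [← Real.rpow_natCast]; push_cast; rfl
  rw [e] at h
  simp only [add_sub_cancel_right, Real.rpow_natCast] at h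
  rw [h, one_div, inv_pow]
  field_simp

lemma tendsto_pow_mul_exp {lam : ℝ} (hl : 0 < lam) (j : ℕ) :
    Tendsto (fun s : ℝ => s ^ j * Real.exp (-(lam * s))) atTop (nhds 0) := by
  have h := (Real.tendsto_pow_mul_exp_neg_atTop_nhds_zero j).comp
    (tendsto_id.const_mul_atTop hl)
  have h2 := h.const_mul ((lam ^ j)⁻¹)
  rw [mul_zero] at h2
  refine h2.congr fun s => ?_
  simp only [Function.comp, id]
  rw [mul_pow]
  field_simp

lemma ndens_expand (μ₁ μ₂ lam : ℝ) (N M : ℕ) (s : ℝ) :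
    ndens μ₁ μ₂ lam N M s = ∑ a ∈ Finset.range (N + 1), ∑ b ∈ Finset.range (M + 1),
      ((N.choose a : ℝ) * (M.choose b : ℝ) * μ₁ ^ a * μ₂ ^ b) *
        (s ^ (a + b) * Real.exp (-(lam * s))) := by
  unfold ndens
  rw [add_comm 1 (μ₁ * s), add_comm 1 (μ₂ * s), add_pow, add_pow, mul_assoc, Finset.sum_mul_sum,
    Finset.mul_sum]
  refine Finset.sum_congr rfl fun a _ => ?_
  rw [Finset.mul_sum]
  refine Finset.sum_congr rfl fun b _ => ?_
  simp only [one_pow, mul_pow, pow_add]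
  ring

lemma ndens_integrable (μ₁ μ₂ : ℝ) {lam : ℝ} (hl : 0 < lam) (N M : ℕ) :
    IntegrableOn (ndens μ₁ μ₂ lam N M) (Ioi 0) := by
  have : ndens μ₁ μ₂ lam N M = fun s => _ := funext (ndens_expand μ₁ μ₂ lam N M)
  rw [this]
  exact integrable_finsetSum _ fun a _ => integrable_finsetSum _ fun b _ =>
    (integrableOn_pow_mul_exp hl _).const_mul _

lemma ndens_tendsto (μ₁ μ₂ : ℝ) {lam : ℝ} (hl : 0 < lam) (N M : ℕ) :
    Tendsto (ndens μ₁ μ₂ lam N M) atTop (nhds 0) := by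
  have : ndens μ₁ μ₂ lam N M = fun s => _ := funext (ndens_expand μ₁ μ₂ lam N M)
  rw [this]
  have h := tendsto_finsetSum (Finset.range (N + 1)) fun a _ =>
    tendsto_finsetSum (Finset.range (M + 1)) fun b _ =>
      (tendsto_pow_mul_exp hl (a + b)).const_mul
        ((N.choose a : ℝ) * (M.choose b : ℝ) * μ₁ ^ a * μ₂ ^ b)
  simpa using h

lemma nmom_one_eq (μ₁ μ₂ : ℝ) {lam : ℝ} (hl : 0 < lam) (N M : ℕ) :
    nmom μ₁ μ₂ lam N M (fun _ => 1) =
      ∑ a ∈ Finset.range (N + 1), ∑ b ∈ Finset.range (M + 1),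
      ((N.choose a : ℝ) * (M.choose b : ℝ) * μ₁ ^ a * μ₂ ^ b) *
        ((a + b).factorial / lam ^ (a + b + 1)) := by
  unfold nmom
  simp only [one_mul, ndens_expand]
  rw [integral_finsetSum _ fun a _ => integrable_finsetSum _ fun b _ =>
    (integrableOn_pow_mul_exp hl _).const_mul _]
  refine Finset.sum_congr rfl fun a _ => ?_
  rw [integral_finsetSum _ fun b _ => (integrableOn_pow_mul_exp hl _).const_mul _]
  refine Finset.sum_congr rfl fun b _ => ?_
  rw [integral_const_mul, integral_pow_mul_exp hl]

variable {μ₁ μ₂ lam : ℝ} {N M : ℕ}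

lemma ndens_pos (h1 : 0 < μ₁) (h2 : 0 < μ₂) {s : ℝ} (hs : 0 < s) :
    0 < ndens μ₁ μ₂ lam N M s := by
  unfold ndens; positivity

lemma nmom_integrable (hl : 0 < lam) {f : ℝ → ℝ} (hf : Measurable f) {C : ℝ}
    (hC : ∀ s, 0 < s → |f s| ≤ C) :
    IntegrableOn (fun s => f s * ndens μ₁ μ₂ lam N M s) (Ioi 0) := by
  refine (ndens_integrable μ₁ μ₂ hl N M).bdd_mul (c := C) hf.aestronglyMeasurable ?_
  exact (ae_restrict_iff' measurableSet_Ioi).2 (Eventually.of_forall fun s hs => hC s hs)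

/-- Bounded measurable test functions on the half line. -/
def BddTest (f : ℝ → ℝ) : Prop := Measurable f ∧ ∃ C, ∀ s, 0 < s → |f s| ≤ C

lemma BddTest.integrable (hl : 0 < lam) {f : ℝ → ℝ} (hf : BddTest f) :
    IntegrableOn (fun s => f s * ndens μ₁ μ₂ lam N M s) (Ioi 0) := by
  obtain ⟨h, C, hC⟩ := hf
  exact nmom_integrable hl h hC

lemma BddTest.const (c : ℝ) : BddTest fun _ => c :=
  ⟨measurable_const, |c|, fun _ _ => le_rfl⟩

lemma BddTest.add {f g : ℝ → ℝ} (hf : BddTest f) (hg : BddTest g) :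
    BddTest fun s => f s + g s := by
  obtain ⟨h, C, hC⟩ := hf
  obtain ⟨h', C', hC'⟩ := hg
  exact ⟨h.add h', C + C', fun s hs => (abs_add_le _ _).trans (add_le_add (hC s hs) (hC' s hs))⟩

lemma BddTest.mul {f g : ℝ → ℝ} (hf : BddTest f) (hg : BddTest g) :
    BddTest fun s => f s * g s := by
  obtain ⟨h, C, hC⟩ := hf
  obtain ⟨h', C', hC'⟩ := hg
  refine ⟨h.mul h', C * C', fun s hs => ?_⟩
  rw [abs_mul]
  exact mul_le_mul (hC s hs) (hC' s hs) (abs_nonneg _) ((abs_nonneg _).trans (hC s hs))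

lemma BddTest.sub {f g : ℝ → ℝ} (hf : BddTest f) (hg : BddTest g) :
    BddTest fun s => f s - g s := by
  have := hf.add ((BddTest.const (-1)).mul hg)
  simpa [sub_eq_add_neg] using this

lemma BddTest.pow {f : ℝ → ℝ} (hf : BddTest f) (k : ℕ) : BddTest fun s => f s ^ k := by
  induction k with
  | zero => simpa using BddTest.const 1
  | succ k ih => simpa only [pow_succ] using ih.mul hf

lemma inv_one_add_mem {μ s : ℝ} (h : 0 < μ) (hs : 0 ≤ s) :
    0 < (1 + μ * s)⁻¹ ∧ (1 + μ * s)⁻¹ ≤ 1 := by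
  refine ⟨by positivity, inv_le_one_of_one_le₀ ?_⟩
  have := mul_nonneg h.le hs
  linarith

lemma BddTest.inv {μ : ℝ} (h : 0 < μ) : BddTest fun s => (1 + μ * s)⁻¹ := by
  refine ⟨by fun_prop, 1, fun s hs => ?_⟩
  obtain ⟨h1, h2⟩ := inv_one_add_mem h hs.le
  rwa [abs_of_pos h1]

lemma nmom_add (hl : 0 < lam) {f g : ℝ → ℝ} (hf : BddTest f) (hg : BddTest g) :
    nmom μ₁ μ₂ lam N M (fun s => f s + g s) =
      nmom μ₁ μ₂ lam N M f + nmom μ₁ μ₂ lam N M g := by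
  unfold nmom
  rw [← integral_add (hf.integrable hl) (hg.integrable hl)]
  simp only [add_mul]

lemma nmom_const_mul (c : ℝ) (f : ℝ → ℝ) :
    nmom μ₁ μ₂ lam N M (fun s => c * f s) = c * nmom μ₁ μ₂ lam N M f := by
  unfold nmom
  rw [← integral_const_mul]
  simp only [mul_assoc]

lemma nmom_sub (hl : 0 < lam) {f g : ℝ → ℝ} (hf : BddTest f) (hg : BddTest g) :
    nmom μ₁ μ₂ lam N M (fun s => f s - g s) =
      nmom μ₁ μ₂ lam N M f - nmom μ₁ μ₂ lam N M g := by
  unfold nmom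
  rw [← integral_sub (hf.integrable hl) (hg.integrable hl)]
  simp only [sub_mul]

lemma nmom_const (c : ℝ) :
    nmom μ₁ μ₂ lam N M (fun _ => c) = c * nmom μ₁ μ₂ lam N M (fun _ => 1) := by
  rw [← nmom_const_mul]; simp

lemma nmom_mono (h1 : 0 < μ₁) (h2 : 0 < μ₂) (hl : 0 < lam) {f g : ℝ → ℝ}
    (hf : BddTest f) (hg : BddTest g) (hfg : ∀ s, 0 < s → f s ≤ g s) :
    nmom μ₁ μ₂ lam N M f ≤ nmom μ₁ μ₂ lam N M g :=
  setIntegral_mono_on (hf.integrable hl) (hg.integrable hl) measurableSet_Ioi fun s hs =>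
    mul_le_mul_of_nonneg_right (hfg s hs) (ndens_pos h1 h2 hs).le

lemma nmom_pos (h1 : 0 < μ₁) (h2 : 0 < μ₂) (hl : 0 < lam) {f : ℝ → ℝ}
    (hf : BddTest f) (hpos : ∀ s, 0 < s → 0 < f s) : 0 < nmom μ₁ μ₂ lam N M f := by
  unfold nmom
  rw [setIntegral_pos_iff_support_of_nonneg_ae]
  · have : (Function.support fun s => f s * ndens μ₁ μ₂ lam N M s) ∩ Ioi 0 = Ioi 0 := by
      refine inter_eq_right.2 fun s hs => ?_
      exact (mul_pos (hpos s hs) (ndens_pos h1 h2 hs)).ne'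
    rw [this]; simp
  · exact (ae_restrict_iff' measurableSet_Ioi).2 (Eventually.of_forall fun s hs =>
      (mul_pos (hpos s hs) (ndens_pos h1 h2 hs)).le)
  · exact hf.integrable hl

lemma hasDerivAt_one_add_pow {μ s : ℝ} (h : 1 + μ * s ≠ 0) (n : ℕ) :
    HasDerivAt (fun s : ℝ => (1 + μ * s) ^ n)
      (n * μ * (1 + μ * s)⁻¹ * (1 + μ * s) ^ n) s := by
  have h0 : HasDerivAt (fun s : ℝ => 1 + μ * s) μ s := by
    simpa using ((hasDerivAt_id s).const_mul μ).const_add 1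
  refine (h0.fun_pow n).congr_deriv ?_
  cases n with
  | zero => simp
  | succ n => simp only [Nat.add_sub_cancel, pow_succ]; field_simp

lemma hasDerivAt_inv_one_add {μ s : ℝ} (h : 1 + μ * s ≠ 0) :
    HasDerivAt (fun s : ℝ => (1 + μ * s)⁻¹) (-(μ * ((1 + μ * s)⁻¹) ^ 2)) s := by
  have h0 : HasDerivAt (fun s : ℝ => 1 + μ * s) μ s := by
    simpa using ((hasDerivAt_id s).const_mul μ).const_add 1
  refine (h0.fun_inv h).congr_deriv ?_
  field_simp

/-- The logarithmic derivative of `ndens`. -/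
noncomputable def nlogDeriv (μ₁ μ₂ lam : ℝ) (N M : ℕ) (s : ℝ) : ℝ :=
  N * μ₁ * (1 + μ₁ * s)⁻¹ + M * μ₂ * (1 + μ₂ * s)⁻¹ - lam

lemma ndens_hasDerivAt (h1 : 0 < μ₁) (h2 : 0 < μ₂) {s : ℝ} (hs : 0 ≤ s) :
    HasDerivAt (ndens μ₁ μ₂ lam N M)
      (nlogDeriv μ₁ μ₂ lam N M s * ndens μ₁ μ₂ lam N M s) s := by
  have e1 : 1 + μ₁ * s ≠ 0 := by positivity
  have e2 : 1 + μ₂ * s ≠ 0 := by positivity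
  have h0 : HasDerivAt (fun s : ℝ => Real.exp (-(lam * s)))
      (Real.exp (-(lam * s)) * (-lam)) s := by
    have : HasDerivAt (fun s : ℝ => -(lam * s)) (-lam) s := by
      simpa using ((hasDerivAt_id s).const_mul lam).fun_neg
    exact this.exp
  have := (h0.mul (hasDerivAt_one_add_pow e1 N)).mul (hasDerivAt_one_add_pow e2 M)
  refine this.congr_deriv ?_
  simp only [nlogDeriv, ndens, Pi.mul_apply]
  ring

lemma BddTest.nlogDeriv (h1 : 0 < μ₁) (h2 : 0 < μ₂) : BddTest (nlogDeriv μ₁ μ₂ lam N M) :=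
  (((BddTest.const _).mul (BddTest.inv h1)).add
    ((BddTest.const _).mul (BddTest.inv h2))).sub (BddTest.const lam)

/-- Integration by parts against `ndens`. -/
lemma nmom_by_parts (h1 : 0 < μ₁) (h2 : 0 < μ₂) (hl : 0 < lam) {f f' : ℝ → ℝ}
    (hf : BddTest f) (hf' : BddTest f') (hd : ∀ s, 0 ≤ s → HasDerivAt f (f' s) s) :
    nmom μ₁ μ₂ lam N M (fun s => f' s + f s * nlogDeriv μ₁ μ₂ lam N M s) = -f 0 := by
  have key : ∀ s, 0 ≤ s → HasDerivAt (fun s => f s * ndens μ₁ μ₂ lam N M s)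
      ((f' s + f s * nlogDeriv μ₁ μ₂ lam N M s) * ndens μ₁ μ₂ lam N M s) s := by
    intro s hs
    refine ((hd s hs).mul (ndens_hasDerivAt h1 h2 hs)).congr_deriv ?_
    ring
  have ht : Tendsto (fun s => f s * ndens μ₁ μ₂ lam N M s) atTop (nhds 0) := by
    obtain ⟨_, C, hC⟩ := hf
    have h := ((ndens_tendsto μ₁ μ₂ hl N M).const_mul C)
    rw [mul_zero] at h
    refine squeeze_zero_norm' ?_ h
    filter_upwards [eventually_gt_atTop 0] with s hs
    rw [norm_mul, Real.norm_eq_abs, Real.norm_eq_abs, abs_of_pos (ndens_pos h1 h2 hs)]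
    exact mul_le_mul_of_nonneg_right (hC s hs) (ndens_pos h1 h2 hs).le
  have := integral_Ioi_of_hasDerivAt_of_tendsto (key 0 le_rfl).continuousAt.continuousWithinAt
    (fun s hs => key s (le_of_lt hs))
    ((hf'.add (hf.mul (BddTest.nlogDeriv h1 h2))).integrable hl) ht
  unfold nmom
  rw [this]
  simp [ndens]

lemma nmom_recursion (h1 : 0 < μ₁) (h2 : 0 < μ₂) (hl : 0 < lam) (k : ℕ) :
    lam * nmom μ₁ μ₂ lam N M (fun s => ((1 + μ₂ * s)⁻¹) ^ k) =
      1 + N * μ₁ * nmom μ₁ μ₂ lam N M (fun s => (1 + μ₁ * s)⁻¹ * ((1 + μ₂ * s)⁻¹) ^ k) +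
        (M - k) * μ₂ * nmom μ₁ μ₂ lam N M (fun s => ((1 + μ₂ * s)⁻¹) ^ (k + 1)) := by
  have hu := BddTest.inv h2
  have hv := BddTest.inv h1
  have h := nmom_by_parts (N := N) (M := M) h1 h2 hl (hu.pow k)
    ((BddTest.const (-(k * μ₂))).mul (hu.pow (k + 1))) (by
      intro s hs
      have e2 : 1 + μ₂ * s ≠ 0 := by positivity
      refine ((hasDerivAt_inv_one_add e2).fun_pow k).congr_deriv ?_
      cases k with
      | zero => simp
      | succ k => simp only [Nat.add_sub_cancel, pow_succ]; push_cast; ring)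
  have e : (fun s => -(k * μ₂) * (1 + μ₂ * s)⁻¹ ^ (k + 1) +
      (1 + μ₂ * s)⁻¹ ^ k * nlogDeriv μ₁ μ₂ lam N M s) = fun s =>
      (((M - k) * μ₂) * (1 + μ₂ * s)⁻¹ ^ (k + 1) +
        (N * μ₁) * ((1 + μ₁ * s)⁻¹ * (1 + μ₂ * s)⁻¹ ^ k)) - lam * (1 + μ₂ * s)⁻¹ ^ k := by
    funext s
    simp only [nlogDeriv, pow_succ]; ring
  rw [e, nmom_sub hl (((BddTest.const _).mul (hu.pow _)).add
      ((BddTest.const _).mul (hv.mul (hu.pow _)))) ((BddTest.const _).mul (hu.pow _)),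
    nmom_add hl ((BddTest.const _).mul (hu.pow _)) ((BddTest.const _).mul (hv.mul (hu.pow _))),
    nmom_const_mul, nmom_const_mul, nmom_const_mul] at h
  simp only [mul_zero, add_zero, inv_one, one_pow] at h
  linarith

lemma nmom_nlogDeriv (h1 : 0 < μ₁) (h2 : 0 < μ₂) (hl : 0 < lam) :
    nmom μ₁ μ₂ lam N M (nlogDeriv μ₁ μ₂ lam N M) = -1 := by
  have h := nmom_by_parts (N := N) (M := M) h1 h2 hl (BddTest.const 1) (BddTest.const 0)
    (fun s _ => hasDerivAt_const s _)
  simpa using h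

lemma nmom_nlogDeriv_sq_le (h1 : 0 < μ₁) (h2 : 0 < μ₂) (hl : 0 < lam)
    (h0 : lam ≤ N * μ₁ + M * μ₂) :
    nmom μ₁ μ₂ lam N M (fun s => nlogDeriv μ₁ μ₂ lam N M s ^ 2) ≤
      (N * μ₁ ^ 2 + M * μ₂ ^ 2) * nmom μ₁ μ₂ lam N M (fun _ => 1) := by
  have hu := BddTest.inv h2
  have hv := BddTest.inv h1
  have hG := BddTest.nlogDeriv (lam := lam) (N := N) (M := M) h1 h2
  have hG' : BddTest fun s => (N * μ₁) * -(μ₁ * (1 + μ₁ * s)⁻¹ ^ 2) +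
      (M * μ₂) * -(μ₂ * (1 + μ₂ * s)⁻¹ ^ 2) := by
    have := ((BddTest.const (-(N * μ₁ ^ 2))).mul (hv.pow 2)).add
      ((BddTest.const (-(M * μ₂ ^ 2))).mul (hu.pow 2))
    convert this using 2
    ring
  have h := nmom_by_parts (N := N) (M := M) h1 h2 hl hG hG' (by
      intro s hs
      have e1 : 1 + μ₁ * s ≠ 0 := by positivity
      have e2 : 1 + μ₂ * s ≠ 0 := by positivity
      exact (((hasDerivAt_inv_one_add e1).const_mul (N * μ₁)).add
        ((hasDerivAt_inv_one_add e2).const_mul (M * μ₂))).sub_const lam)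
  rw [← nmom_const]
  have hle : nmom μ₁ μ₂ lam N M (fun s => nlogDeriv μ₁ μ₂ lam N M s ^ 2 -
      (N * μ₁ ^ 2 + M * μ₂ ^ 2)) ≤ -nlogDeriv μ₁ μ₂ lam N M 0 := by
    rw [← h]
    refine nmom_mono h1 h2 hl ((hG.pow 2).sub (BddTest.const _)) (hG'.add (hG.mul hG))
      fun s hs => ?_
    obtain ⟨p1, p2⟩ := inv_one_add_mem h1 hs.le
    obtain ⟨q1, q2⟩ := inv_one_add_mem h2 hs.le
    have a1 : (1 + μ₁ * s)⁻¹ ^ 2 ≤ 1 := pow_le_one₀ p1.le p2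
    have a2 : (1 + μ₂ * s)⁻¹ ^ 2 ≤ 1 := pow_le_one₀ q1.le q2
    have b1 := mul_le_mul_of_nonneg_left a1 (show 0 ≤ N * μ₁ ^ 2 by positivity)
    have b2 := mul_le_mul_of_nonneg_left a2 (show 0 ≤ M * μ₂ ^ 2 by positivity)
    nlinarith
  rw [nmom_sub hl (hG.pow 2) (BddTest.const _)] at hle
  have : 0 ≤ nlogDeriv μ₁ μ₂ lam N M 0 := by simp [nlogDeriv]; linarith
  linarith

/-- Cauchy–Schwarz against the constant function. -/
lemma sq_nmom_le (h1 : 0 < μ₁) (h2 : 0 < μ₂) (hl : 0 < lam) {f : ℝ → ℝ} (hf : BddTest f) :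
    (nmom μ₁ μ₂ lam N M f / nmom μ₁ μ₂ lam N M (fun _ => 1)) ^ 2 ≤
      nmom μ₁ μ₂ lam N M (fun s => f s ^ 2) / nmom μ₁ μ₂ lam N M (fun _ => 1) := by
  have hJ : 0 < nmom μ₁ μ₂ lam N M (fun _ => 1) :=
    nmom_pos h1 h2 hl (BddTest.const 1) fun _ _ => one_pos
  set c := nmom μ₁ μ₂ lam N M f / nmom μ₁ μ₂ lam N M (fun _ => 1) with hc
  have hcf : nmom μ₁ μ₂ lam N M f = c * nmom μ₁ μ₂ lam N M (fun _ => 1) := by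
    rw [hc]; field_simp
  have h := nmom_mono (N := N) (M := M) h1 h2 hl
    (((BddTest.const (2 * c)).mul hf).sub (BddTest.const (c ^ 2))) (hf.pow 2)
    (fun s _ => by nlinarith [sq_nonneg (f s - c)])
  rw [nmom_sub hl ((BddTest.const _).mul hf) (BddTest.const _), nmom_const_mul, nmom_const (c ^ 2),
    hcf] at h
  rw [le_div_iff₀ hJ]
  nlinarith

/-- Chebyshev's correlation inequality for two decreasing functions. -/
lemma nmom_chebyshev (h1 : 0 < μ₁) (h2 : 0 < μ₂) (hl : 0 < lam) (k : ℕ) :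
    nmom μ₁ μ₂ lam N M (fun s => (1 + μ₁ * s)⁻¹) *
        nmom μ₁ μ₂ lam N M (fun s => ((1 + μ₂ * s)⁻¹) ^ k) ≤
      nmom μ₁ μ₂ lam N M (fun s => (1 + μ₁ * s)⁻¹ * ((1 + μ₂ * s)⁻¹) ^ k) *
        nmom μ₁ μ₂ lam N M (fun _ => 1) := by
  have hu := BddTest.inv h2
  have hv := BddTest.inv h1
  have hJ : 0 < nmom μ₁ μ₂ lam N M (fun _ => 1) :=
    nmom_pos h1 h2 hl (BddTest.const 1) fun _ _ => one_pos
  set J := nmom μ₁ μ₂ lam N M (fun _ => 1)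
  set V := nmom μ₁ μ₂ lam N M (fun s => (1 + μ₁ * s)⁻¹) with hV
  have hVpos : 0 < V := nmom_pos h1 h2 hl hv fun s hs => (inv_one_add_mem h1 hs.le).1
  have hVle : V ≤ J := nmom_mono h1 h2 hl hv (BddTest.const 1)
    fun s hs => (inv_one_add_mem h1 hs.le).2
  set c := V / J with hc
  have hcpos : 0 < c := by positivity
  have hcle : c ≤ 1 := (div_le_one hJ).2 hVle
  set s₀ := (1 / c - 1) / μ₁ with hs₀
  have hs₀0 : 0 ≤ s₀ := div_nonneg (sub_nonneg.2 ((one_le_div hcpos).2 hcle)) h1.le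
  have hs₀c : (1 + μ₁ * s₀)⁻¹ = c := by
    rw [hs₀]; field_simp; ring
  set d := ((1 + μ₂ * s₀)⁻¹) ^ k with hd
  have h := nmom_mono (N := N) (M := M) h1 h2 hl
    (((BddTest.const c).mul (hu.pow k)).add ((BddTest.const d).mul (hv.sub (BddTest.const c))))
    (hv.mul (hu.pow k)) (fun s hs => by
      have anti : ∀ {μ a b : ℝ}, 0 < μ → 0 ≤ a → a ≤ b → (1 + μ * b)⁻¹ ≤ (1 + μ * a)⁻¹ :=
        fun hμ ha hab => inv_anti₀ (by positivity) (by gcongr)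
      rcases le_total s s₀ with hle | hle
      · have a1 := anti h1 hs.le hle
        have a2 := pow_le_pow_left₀ (inv_one_add_mem h2 hs₀0).1.le (anti h2 hs.le hle) k
        rw [hs₀c] at a1
        nlinarith [mul_nonneg (sub_nonneg.2 a1) (sub_nonneg.2 a2)]
      · have a1 := anti h1 hs₀0 hle
        have a2 := pow_le_pow_left₀ (inv_one_add_mem h2 hs.le).1.le (anti h2 hs₀0 hle) k
        rw [hs₀c] at a1
        nlinarith [mul_nonneg (sub_nonneg.2 a1) (sub_nonneg.2 a2)])
  rw [nmom_add hl ((BddTest.const c).mul (hu.pow k))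
      ((BddTest.const d).mul (hv.sub (BddTest.const c))), nmom_const_mul, nmom_const_mul,
    nmom_sub hl hv (BddTest.const c), nmom_const c] at h
  have hVc : V = c * J := by rw [hc]; field_simp
  have : V - c * J = 0 := by linarith
  change c * _ + d * (V - c * J) ≤ _ at h
  rw [this, mul_zero, add_zero] at h
  rw [hVc]
  nlinarith [mul_le_mul_of_nonneg_right h hJ.le]

end Density

section Ratio

/-- Geometric domination of the bulk weight of level `k`. -/
lemma descFactorial_mul_nmom_le {μ₁ μ₂ lam α : ℝ} (h1 : 0 < μ₁) (h2 : 0 < μ₂) (hl : 0 < lam)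
    (hα : 0 < α) (N M k : ℕ) :
    (M.descFactorial k : ℝ) * (μ₂ / (α * lam)) ^ k *
        nmom μ₁ μ₂ lam N M (fun s => ((1 + μ₂ * s)⁻¹) ^ k) ≤
      (M * (μ₂ / (α * lam)) * (nmom μ₁ μ₂ lam N M (fun s => (1 + μ₂ * s)⁻¹) /
        nmom μ₁ μ₂ lam N M (fun _ => 1))) ^ k * nmom μ₁ μ₂ lam N M (fun _ => 1) := by
  have hu := BddTest.inv h2
  have hv := BddTest.inv h1
  set J := nmom μ₁ μ₂ lam N M (fun _ => 1) with hJdef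
  have hJ : 0 < J := nmom_pos h1 h2 hl (BddTest.const 1) fun _ _ => one_pos
  have hU : ∀ k : ℕ, 0 < nmom μ₁ μ₂ lam N M (fun s => ((1 + μ₂ * s)⁻¹) ^ k) := fun k =>
    nmom_pos h1 h2 hl (hu.pow k) fun s hs => pow_pos (inv_one_add_mem h2 hs.le).1 k
  have hUle : ∀ k : ℕ, nmom μ₁ μ₂ lam N M (fun s => ((1 + μ₂ * s)⁻¹) ^ k) ≤ J := fun k =>
    nmom_mono h1 h2 hl (hu.pow k) (BddTest.const 1) fun s hs =>
      pow_le_one₀ (inv_one_add_mem h2 hs.le).1.le (inv_one_add_mem h2 hs.le).2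
  have hU1 : 0 < nmom μ₁ μ₂ lam N M (fun s => (1 + μ₂ * s)⁻¹) := by simpa using hU 1
  have rec0 := nmom_recursion (N := N) (M := M) h1 h2 hl 0
  simp only [pow_zero, mul_one, Nat.cast_zero, sub_zero, zero_add, pow_one] at rec0
  rw [← hJdef] at rec0
  induction k with
  | zero => simp [← hJdef]
  | succ k ih =>
    rcases lt_or_ge k M with hk | hk
    · have reck := nmom_recursion (N := N) (M := M) h1 h2 hl k
      have cheb := nmom_chebyshev (N := N) (M := M) h1 h2 hl k
      rw [← hJdef] at cheb
      have hq : 0 < μ₂ / (α * lam) := by positivity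
      set U := nmom μ₁ μ₂ lam N M (fun s => ((1 + μ₂ * s)⁻¹) ^ k)
      set U' := nmom μ₁ μ₂ lam N M (fun s => ((1 + μ₂ * s)⁻¹) ^ (k + 1))
      set U1 := nmom μ₁ μ₂ lam N M (fun s => (1 + μ₂ * s)⁻¹)
      set V := nmom μ₁ μ₂ lam N M (fun s => (1 + μ₁ * s)⁻¹)
      set V' := nmom μ₁ μ₂ lam N M (fun s => (1 + μ₁ * s)⁻¹ * ((1 + μ₂ * s)⁻¹) ^ k)
      have hkey : (M - k) * U' ≤ M * (U1 / J) * U := by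
        have e1 : (M - k) * μ₂ * U' * J = lam * U * J - J - N * μ₁ * (V' * J) := by
          linear_combination (-J) * reck
        have e2 : M * μ₂ * U1 * U = lam * U * J - U - N * μ₁ * (V * U) := by
          linear_combination (-U) * rec0
        have hN : 0 ≤ N * μ₁ := by positivity
        have e3 := mul_le_mul_of_nonneg_left cheb hN
        have e4 : (M - k) * μ₂ * U' * J ≤ M * μ₂ * U1 * U := by
          rw [e1, e2]; linarith [hUle k]
        rw [mul_div_assoc', div_mul_eq_mul_div, le_div_iff₀ hJ]
        refine le_of_mul_le_mul_left ?_ h2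
        linarith
      have hd : (M.descFactorial (k + 1) : ℝ) = (M - k) * M.descFactorial k := by
        rw [Nat.descFactorial_succ, Nat.cast_mul, Nat.cast_sub hk.le]
      have c1 := mul_le_mul_of_nonneg_left hkey
        (show 0 ≤ (M.descFactorial k : ℝ) * (μ₂ / (α * lam)) ^ (k + 1) by positivity)
      have c2 := mul_le_mul_of_nonneg_left ih
        (show 0 ≤ M * (μ₂ / (α * lam)) * (U1 / J) by positivity)
      rw [hd]
      calc _ = (M.descFactorial k : ℝ) * (μ₂ / (α * lam)) ^ (k + 1) * ((M - k) * U') := by ring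
        _ ≤ _ := c1
        _ = M * (μ₂ / (α * lam)) * (U1 / J) *
            ((M.descFactorial k : ℝ) * (μ₂ / (α * lam)) ^ k * U) := by ring
        _ ≤ _ := c2
        _ = _ := by ring
    · rw [Nat.descFactorial_of_lt (by omega)]
      simp only [Nat.cast_zero, zero_mul]
      positivity

end Ratio

section Limits

open MeasureTheory

variable {μ₁ μ₂ θ L T : ℝ} {N M : ℕ → ℕ} {lam : ℕ → ℝ}

/-- The normalised second moment of the scaled logarithmic derivative of the density tends to zero. -/
lemma tendsto_nlogDeriv_sq (h1 : 0 < μ₁) (h2 : 0 < μ₂)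
    (hN : Tendsto (fun n => (N n : ℝ) / n) atTop (nhds θ))
    (hM : Tendsto (fun n => (M n : ℝ) / n) atTop (nhds (1 - θ)))
    (hlam : Tendsto (fun n => lam n / n) atTop (nhds L))
    (hpos : ∀ᶠ n in atTop, 0 < lam n) (hL : L < θ * μ₁ + (1 - θ) * μ₂) :
    Tendsto (fun n : ℕ => nmom μ₁ μ₂ (lam n) (N n) (M n)
      (fun s => (nlogDeriv μ₁ μ₂ (lam n) (N n) (M n) s / n) ^ 2) /
        nmom μ₁ μ₂ (lam n) (N n) (M n) (fun _ => 1)) atTop (nhds 0) := by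
  have hb : Tendsto (fun n : ℕ => ((N n : ℝ) / n * μ₁ ^ 2 + (M n : ℝ) / n * μ₂ ^ 2) *
      ((n : ℝ))⁻¹) atTop (nhds 0) := by
    have := ((hN.mul_const (μ₁ ^ 2)).add (hM.mul_const (μ₂ ^ 2))).mul
      (tendsto_inv_atTop_nhds_zero_nat (𝕜 := ℝ))
    simpa using this
  have hdrift : ∀ᶠ n : ℕ in atTop, lam n / n < (N n : ℝ) / n * μ₁ + (M n : ℝ) / n * μ₂ :=
    hlam.eventually_lt ((hN.mul_const μ₁).add (hM.mul_const μ₂)) hL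
  refine squeeze_zero' ?_ ?_ hb
  · filter_upwards [hpos] with n hl
    refine div_nonneg ?_
      (nmom_pos h1 h2 hl (BddTest.const 1) fun _ _ => one_pos).le
    exact setIntegral_nonneg measurableSet_Ioi fun s hs =>
      mul_nonneg (sq_nonneg _) (ndens_pos h1 h2 hs).le
  · filter_upwards [hpos, hdrift, eventually_gt_atTop 0] with n hl hd hn
    have hn' : (0 : ℝ) < n := by exact_mod_cast hn
    have hJ : 0 < nmom μ₁ μ₂ (lam n) (N n) (M n) (fun _ => 1) :=
      nmom_pos h1 h2 hl (BddTest.const 1) fun _ _ => one_pos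
    have hle : lam n ≤ N n * μ₁ + M n * μ₂ := by
      have := mul_lt_mul_of_pos_right hd hn'
      field_simp at this
      linarith
    have h := nmom_nlogDeriv_sq_le h1 h2 hl hle
    have e : (fun s => (nlogDeriv μ₁ μ₂ (lam n) (N n) (M n) s / n) ^ 2) = fun s =>
        ((n : ℝ) ^ 2)⁻¹ * nlogDeriv μ₁ μ₂ (lam n) (N n) (M n) s ^ 2 := by
      funext s; rw [div_pow]; ring
    rw [e, nmom_const_mul, div_le_iff₀ hJ]
    calc _ ≤ ((n : ℝ) ^ 2)⁻¹ * _ := mul_le_mul_of_nonneg_left h (by positivity)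
      _ = _ := by field_simp

lemma tendsto_inv_mul_nmom (h1 : 0 < μ₁) (h2 : 0 < μ₂)
    (hN : Tendsto (fun n => (N n : ℝ) / n) atTop (nhds θ))
    (hM : Tendsto (fun n => (M n : ℝ) / n) atTop (nhds (1 - θ)))
    (hlam : Tendsto (fun n => lam n / n) atTop (nhds L))
    (hpos : ∀ᶠ n in atTop, 0 < lam n) (hL : L < θ * μ₁ + (1 - θ) * μ₂) :
    Tendsto (fun n : ℕ => (n * nmom μ₁ μ₂ (lam n) (N n) (M n) (fun _ => 1))⁻¹)
      atTop (nhds 0) := by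
  have h := tendsto_nlogDeriv_sq h1 h2 hN hM hlam hpos hL
  have h' := h.sqrt
  rw [Real.sqrt_zero] at h'
  refine squeeze_zero_norm' ?_ h'
  filter_upwards [hpos, eventually_gt_atTop 0] with n hl hn
  have hn' : (0 : ℝ) < n := by exact_mod_cast hn
  have hG := BddTest.nlogDeriv (lam := lam n) (N := N n) (M := M n) h1 h2
  have h3 := sq_nmom_le (N := N n) (M := M n) h1 h2 hl ((BddTest.const ((n : ℝ)⁻¹)).mul hG)
  rw [nmom_const_mul, nmom_nlogDeriv h1 h2 hl] at h3
  refine Real.le_sqrt_of_sq_le ?_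
  rw [Real.norm_eq_abs, sq_abs]
  convert h3 using 1
  · rw [mul_inv]; ring
  · simp only [div_eq_inv_mul]

lemma sq_pow_sub_pow_le {u w : ℝ} (hu0 : 0 < u) (hu1 : u ≤ 1) (hw0 : 0 < w) (hw1 : w ≤ 1) (k : ℕ) :
    (u ^ k - w ^ k) ^ 2 ≤ (k : ℝ) ^ 2 * (u - w) ^ 2 := by
  have hm : max |u| |w| ^ (k - 1) ≤ 1 := by
    refine pow_le_one₀ (by positivity) (max_le ?_ ?_)
    · rwa [abs_of_pos hu0]
    · rwa [abs_of_pos hw0]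
  have h3 : |u ^ k - w ^ k| ≤ k * |u - w| := by
    refine (abs_pow_sub_pow_le u w k).trans ?_
    calc _ ≤ |u - w| * k * 1 := by gcongr
      _ = _ := by ring
  calc _ = |u ^ k - w ^ k| ^ 2 := (sq_abs _).symm
    _ ≤ (k * |u - w|) ^ 2 := by gcongr
    _ = _ := by rw [mul_pow, sq_abs]

/-- A perturbed drift controls the deviation of each of its two monotone components. -/
lemma drift_sq_lower_bound {μ₁ μ₂ θ L a b l u v uT vT : ℝ} (h1 : 0 < μ₁) (h2 : 0 < μ₂)
    (hθ0 : 0 < θ) (hθ1 : θ < 1) (hroot : L = θ * μ₁ * vT + (1 - θ) * μ₂ * uT)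
    (hv0 : 0 < v) (hv1 : v ≤ 1) (hu0 : 0 < u) (hu1 : u ≤ 1)
    (hsame : 0 ≤ (v - vT) * (u - uT)) :
    ((1 - θ) * μ₂) ^ 2 * (u - uT) ^ 2 ≤ 2 * ((a * μ₁ * v + b * μ₂ * u - l) ^ 2 +
      (μ₁ * |a - θ| + μ₂ * |b - (1 - θ)| + |l - L|) ^ 2) := by
  set g := a * μ₁ * v + b * μ₂ * u - l with hg
  set ψ := θ * μ₁ * v + (1 - θ) * μ₂ * u - L with hψ
  set e := μ₁ * |a - θ| + μ₂ * |b - (1 - θ)| + |l - L| with he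
  have hdiff : |ψ - g| ≤ e := by
    have : ψ - g = -((a - θ) * (μ₁ * v)) + -((b - (1 - θ)) * (μ₂ * u)) + (l - L) := by
      rw [hψ, hg]; ring
    rw [this]
    refine (abs_add_le _ _).trans (add_le_add ((abs_add_le _ _).trans (add_le_add ?_ ?_)) le_rfl)
    · rw [abs_neg, abs_mul, abs_of_pos (mul_pos h1 hv0), mul_comm]
      exact mul_le_mul_of_nonneg_right (mul_le_of_le_one_right h1.le hv1) (abs_nonneg _)
    · rw [abs_neg, abs_mul, abs_of_pos (mul_pos h2 hu0), mul_comm]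
      exact mul_le_mul_of_nonneg_right (mul_le_of_le_one_right h2.le hu1) (abs_nonneg _)
  have hψ2 : ψ ^ 2 ≤ 2 * (g ^ 2 + e ^ 2) := by
    have : (ψ - g) ^ 2 ≤ e ^ 2 := by
      rw [← sq_abs]; exact pow_le_pow_left₀ (abs_nonneg _) hdiff 2
    nlinarith [sq_nonneg (ψ - 2 * g)]
  have hψe : ψ = θ * μ₁ * (v - vT) + (1 - θ) * μ₂ * (u - uT) := by
    rw [hψ, hroot]; ring
  have hc : 0 < (1 - θ) * μ₂ := mul_pos (by linarith) h2
  refine le_trans ?_ hψ2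
  rw [hψe]
  nlinarith [mul_nonneg (mul_pos (mul_pos hθ0 h1) hc).le hsame, sq_nonneg (θ * μ₁ * (v - vT))]

lemma tendsto_nmom_pow (h1 : 0 < μ₁) (h2 : 0 < μ₂) (hθ0 : 0 < θ) (hθ1 : θ < 1) (hT : 0 < T)
    (hN : Tendsto (fun n => (N n : ℝ) / n) atTop (nhds θ))
    (hM : Tendsto (fun n => (M n : ℝ) / n) atTop (nhds (1 - θ)))
    (hlam : Tendsto (fun n => lam n / n) atTop (nhds L))
    (hpos : ∀ᶠ n in atTop, 0 < lam n) (hL : L < θ * μ₁ + (1 - θ) * μ₂)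
    (hroot : L = θ * μ₁ * (1 + μ₁ * T)⁻¹ + (1 - θ) * μ₂ * (1 + μ₂ * T)⁻¹) (k : ℕ) :
    Tendsto (fun n : ℕ => nmom μ₁ μ₂ (lam n) (N n) (M n) (fun s => ((1 + μ₂ * s)⁻¹) ^ k) /
        nmom μ₁ μ₂ (lam n) (N n) (M n) (fun _ => 1)) atTop (nhds (((1 + μ₂ * T)⁻¹) ^ k)) := by
  have hG := tendsto_nlogDeriv_sq h1 h2 hN hM hlam hpos hL
  set e : ℕ → ℝ := fun n => μ₁ * |(N n : ℝ) / n - θ| + μ₂ * |(M n : ℝ) / n - (1 - θ)| +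
    |lam n / n - L| with he
  have het : Tendsto e atTop (nhds 0) := by
    have a1 := (hN.sub_const θ).abs.const_mul μ₁
    have a2 := (hM.sub_const (1 - θ)).abs.const_mul μ₂
    have a3 := (hlam.sub_const L).abs
    simpa using (a1.add a2).add a3
  have hc : 0 < (1 - θ) * μ₂ := mul_pos (by linarith) h2
  have hb : Tendsto (fun n : ℕ => (k : ℝ) ^ 2 * (2 * (nmom μ₁ μ₂ (lam n) (N n) (M n)
      (fun s => (nlogDeriv μ₁ μ₂ (lam n) (N n) (M n) s / n) ^ 2) /
        nmom μ₁ μ₂ (lam n) (N n) (M n) (fun _ => 1)) + 2 * e n ^ 2) / ((1 - θ) * μ₂) ^ 2)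
      atTop (nhds 0) := by
    have := ((((hG.const_mul 2).add ((het.pow 2).const_mul 2)).const_mul ((k : ℝ) ^ 2)).div_const
      (((1 - θ) * μ₂) ^ 2))
    simpa using this
  have hb' := hb.sqrt
  rw [Real.sqrt_zero] at hb'
  rw [tendsto_iff_norm_sub_tendsto_zero]
  refine squeeze_zero' (Eventually.of_forall fun n => norm_nonneg _) ?_ hb'
  filter_upwards [hpos, eventually_gt_atTop 0] with n hl hn
  have hn' : (0 : ℝ) < n := by exact_mod_cast hn
  have hu := BddTest.inv h2
  have hJ : 0 < nmom μ₁ μ₂ (lam n) (N n) (M n) (fun _ => 1) :=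
    nmom_pos h1 h2 hl (BddTest.const 1) fun _ _ => one_pos
  have hGt : BddTest fun s => nlogDeriv μ₁ μ₂ (lam n) (N n) (M n) s / n := by
    simpa only [div_eq_inv_mul] using
      (BddTest.const ((n : ℝ)⁻¹)).mul (BddTest.nlogDeriv (lam := lam n) h1 h2)
  set J := nmom μ₁ μ₂ (lam n) (N n) (M n) (fun _ => 1) with hJdef
  set uT := (1 + μ₂ * T)⁻¹ with huT
  set vT := (1 + μ₁ * T)⁻¹ with hvT
  have hcs := sq_nmom_le (N := N n) (M := M n) h1 h2 hl ((hu.pow k).sub (BddTest.const (uT ^ k)))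
  rw [nmom_sub hl (hu.pow k) (BddTest.const _), nmom_const (uT ^ k), ← hJdef, sub_div,
    mul_div_assoc, div_self hJ.ne', mul_one] at hcs
  refine Real.le_sqrt_of_sq_le ?_
  rw [Real.norm_eq_abs, sq_abs]
  refine hcs.trans ?_
  have hmono := nmom_mono (N := N n) (M := M n) h1 h2 hl
    (((hu.pow k).sub (BddTest.const (uT ^ k))).pow 2)
    ((BddTest.const ((k : ℝ) ^ 2 * 2 / ((1 - θ) * μ₂) ^ 2)).mul
      ((hGt.pow 2).add (BddTest.const (e n ^ 2)))) (by
    intro s hs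
    obtain ⟨p1, p2⟩ := inv_one_add_mem h1 hs.le
    obtain ⟨q1, q2⟩ := inv_one_add_mem h2 hs.le
    obtain ⟨p1', p2'⟩ := inv_one_add_mem h1 hT.le
    obtain ⟨q1', q2'⟩ := inv_one_add_mem h2 hT.le
    have anti : ∀ {μ a b : ℝ}, 0 < μ → 0 ≤ a → a ≤ b → (1 + μ * b)⁻¹ ≤ (1 + μ * a)⁻¹ :=
      fun hμ ha hab => inv_anti₀ (by positivity) (by gcongr)
    have hsame : 0 ≤ ((1 + μ₁ * s)⁻¹ - vT) * ((1 + μ₂ * s)⁻¹ - uT) := by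
      rcases le_total s T with hle | hle
      · exact mul_nonneg (sub_nonneg.2 (anti h1 hs.le hle)) (sub_nonneg.2 (anti h2 hs.le hle))
      · exact mul_nonneg_of_nonpos_of_nonpos (sub_nonpos.2 (anti h1 hT.le hle))
          (sub_nonpos.2 (anti h2 hT.le hle))
    have hlip := sq_pow_sub_pow_le q1 q2 q1' q2' k
    have hlow := drift_sq_lower_bound (a := (N n : ℝ) / n) (b := (M n : ℝ) / n) (l := lam n / n)
      h1 h2 hθ0 hθ1 hroot p1 p2 q1 q2 hsame
    have hge : (N n : ℝ) / n * μ₁ * (1 + μ₁ * s)⁻¹ + (M n : ℝ) / n * μ₂ * (1 + μ₂ * s)⁻¹ -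
        lam n / n = nlogDeriv μ₁ μ₂ (lam n) (N n) (M n) s / n := by
      rw [nlogDeriv]; ring
    rw [hge] at hlow
    refine hlip.trans ?_
    rw [div_mul_eq_mul_div, le_div_iff₀ (by positivity)]
    have := mul_le_mul_of_nonneg_left hlow (sq_nonneg (k : ℝ))
    linarith)
  rw [nmom_const_mul, nmom_add hl (hGt.pow 2) (BddTest.const _), nmom_const (e n ^ 2),
    ← hJdef] at hmono
  rw [div_le_iff₀ hJ]
  refine hmono.trans (le_of_eq ?_)
  field_simp

end Limits

section Levels

variable {μ₁ μ₂ θ ρ α : ℝ} {n : ℕ}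

/-- Total weight of the states with a given first coordinate. -/
noncomputable def levelWt (μ₁ μ₂ θ ρ α : ℝ) (n k : ℕ) : ℝ :=
  ∑' p : ℕ × ℕ, Nwt μ₁ μ₂ θ ρ α n (k, p)

lemma Nwt_eq_zero {k i₁ i₂ : ℕ} (h : ¬(k ≤ Npool2 θ n ∧ i₁ ≤ Npool1 θ n ∧ i₂ ≤ Npool2 θ n)) :
    Nwt μ₁ μ₂ θ ρ α n (k, i₁, i₂) = 0 := by
  simp only [Nwt]
  rw [if_neg (by omega), if_neg (by omega), if_neg (by omega)]

lemma summable_Nwt : Summable (Nwt μ₁ μ₂ θ ρ α n) := by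
  refine summable_of_ne_finset_zero (s := Finset.range (Npool2 θ n + 1) ×ˢ
    (Finset.range (Npool1 θ n + 1) ×ˢ Finset.range (Npool2 θ n + 1))) ?_
  rintro ⟨k, i₁, i₂⟩ h
  refine Nwt_eq_zero fun h' => h ?_
  simp only [Finset.mem_product, Finset.mem_range]
  omega

lemma NP_eq_levelWt (k : ℕ) :
    NP μ₁ μ₂ θ ρ α n {t : ℕ × ℕ × ℕ | t.1 = k} =
      levelWt μ₁ μ₂ θ ρ α n k / ∑' j, levelWt μ₁ μ₂ θ ρ α n j := by
  unfold NP levelWt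
  rw [tsum_subtype {t : ℕ × ℕ × ℕ | t.1 = k} (Nwt μ₁ μ₂ θ ρ α n),
    (summable_Nwt.indicator _).tsum_prod, summable_Nwt.tsum_prod, tsum_eq_single k]
  · congr 1
    refine tsum_congr fun p => ?_
    rw [Set.indicator_of_mem]
    rfl
  · intro j hj
    convert tsum_zero with p
    rw [Set.indicator_of_notMem]
    exact hj

lemma levelWt_eq_zero {k : ℕ} (hk : Npool2 θ n < k) : levelWt μ₁ μ₂ θ ρ α n k = 0 := by
  unfold levelWt
  convert tsum_zero with p
  exact Nwt_eq_zero (by omega)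

lemma levelWt_eq_sum (k : ℕ) : levelWt μ₁ μ₂ θ ρ α n k =
    ∑ a ∈ Finset.range (Npool1 θ n), ∑ b ∈ Finset.range (Npool2 θ n + 1),
      Nwt μ₁ μ₂ θ ρ α n (k, a + 1, b) +
    ∑ b ∈ Finset.range (Npool2 θ n + 1), Nwt μ₁ μ₂ θ ρ α n (k, 0, b) := by
  unfold levelWt
  rw [tsum_eq_sum (s := Finset.range (Npool1 θ n + 1) ×ˢ Finset.range (Npool2 θ n + 1)),
    Finset.sum_product, Finset.sum_range_succ']
  rintro ⟨i₁, i₂⟩ h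
  refine Nwt_eq_zero fun h' => h ?_
  simp only [Finset.mem_product, Finset.mem_range]
  omega

lemma choose_mul_factorial_div (k m b : ℕ) :
    ((k + m).choose (k + b) : ℝ) * (((k + b).factorial : ℝ) / (b.factorial : ℝ)) =
      (k + m).descFactorial k * m.choose b := by
  have e1 : ((k + b).factorial : ℝ) / (b.factorial : ℝ) = (k + b).descFactorial k := by
    rw [div_eq_iff (by positivity), ← Nat.factorial_mul_descFactorial (Nat.le_add_right k b)]
    simp [mul_comm]
  have e2 := Nat.choose_mul (n := k + m) (k := k + b) (s := k) (Nat.le_add_right k b)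
  simp only [Nat.add_sub_cancel_left] at e2
  rw [e1, Nat.descFactorial_eq_factorial_mul_choose, Nat.descFactorial_eq_factorial_mul_choose]
  push_cast
  have e3 : ((k + m).choose (k + b) : ℝ) * (k + b).choose k = (k + m).choose k * m.choose b := by
    exact_mod_cast e2
  linear_combination (k.factorial : ℝ) * e3

lemma nmom_inv_pow {lam : ℝ} (h2 : 0 < μ₂) (N k m : ℕ) :
    nmom μ₁ μ₂ lam N (k + m) (fun s => ((1 + μ₂ * s)⁻¹) ^ k) =
      nmom μ₁ μ₂ lam N m (fun _ => 1) := by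
  refine MeasureTheory.setIntegral_congr_fun measurableSet_Ioi fun s hs => ?_
  have hs' : (0 : ℝ) < s := hs
  have : 1 + μ₂ * s ≠ 0 := by positivity
  simp only [ndens, pow_add, inv_pow]
  field_simp

lemma sum_bulk_Nwt (h2 : 0 < μ₂) (hα : 0 < α) (hl : 0 < Nlam μ₁ μ₂ θ ρ n)
    (hn1 : 1 ≤ Npool1 θ n) {k : ℕ} (hk : k ≤ Npool2 θ n) :
    ∑ a ∈ Finset.range (Npool1 θ n), ∑ b ∈ Finset.range (Npool2 θ n + 1),
      Nwt μ₁ μ₂ θ ρ α n (k, a + 1, b) =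
    Npool1 θ n * μ₁ * (((Npool2 θ n).descFactorial k : ℝ) *
      (μ₂ / (α * Nlam μ₁ μ₂ θ ρ n)) ^ k *
      nmom μ₁ μ₂ (Nlam μ₁ μ₂ θ ρ n) (Npool1 θ n - 1) (Npool2 θ n)
        (fun s => ((1 + μ₂ * s)⁻¹) ^ k)) := by
  obtain ⟨m, hm⟩ := Nat.exists_eq_add_of_le hk
  obtain ⟨N, hN⟩ := Nat.exists_eq_add_of_le' hn1
  set lam := Nlam μ₁ μ₂ θ ρ n with hlam
  have hN' : Npool1 θ n - 1 = N := by omega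
  rw [hN', hN]
  conv_rhs => rw [hm, nmom_inv_pow h2, nmom_one_eq μ₁ μ₂ hl, Finset.mul_sum, Finset.mul_sum]
  refine Finset.sum_congr rfl fun a ha => ?_
  rw [hm, add_assoc k m 1, Finset.sum_range_add, Finset.sum_eq_zero, zero_add, Finset.mul_sum,
    Finset.mul_sum]
  · refine Finset.sum_congr rfl fun b hb => ?_
    rw [Finset.mem_range] at ha hb
    simp only [Nwt]
    rw [if_pos (by omega), hm, hN, ← hlam]
    have e1 : a + 1 + (k + b) - k - 1 = a + b := by omega
    have e2 : k + b - k = b := by omega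
    rw [e1, e2]
    have c1 := choose_mul_factorial_div k m b
    have c2 : ((a + 1 : ℕ) : ℝ) * ((N + 1).choose (a + 1) : ℝ) = (N + 1 : ℕ) * N.choose a := by
      have := Nat.add_one_mul_choose_eq N a
      rw [mul_comm] at this
      norm_cast
      linarith
    calc _ = (((a + 1 : ℕ) : ℝ) * ((N + 1).choose (a + 1) : ℝ)) *
          (((k + m).choose (k + b) : ℝ) * (((k + b).factorial : ℝ) / (b.factorial : ℝ))) *
          ((a + b).factorial * μ₁ ^ (a + 1) * μ₂ ^ (k + b) * (lam ^ (a + 1 + (k + b)))⁻¹ *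
            (lam / (α * lam)) ^ k) := by ring
      _ = _ := by
        rw [c1, c2]
        simp only [div_pow, mul_pow, pow_add, pow_one]
        field_simp
  · intro b hb
    rw [Finset.mem_range] at hb
    simp only [Nwt]
    rw [if_neg (by omega), if_neg (by omega), if_neg (by omega)]

lemma prod_inv_mul_descFactorial_le {D Q : ℝ} (h2 : 0 < μ₂) (hD : 0 < D) (m d : ℕ)
    (hQ : ∀ x : ℕ, x ≤ m + d → μ₂ * x ≤ Q * (D + μ₂ * x)) :
    (∏ l ∈ Finset.range (d + 1), (D + μ₂ * ((m + l : ℕ) : ℝ))⁻¹) * μ₂ ^ d *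
      (m + d).descFactorial d ≤ Q ^ d / D := by
  induction d with
  | zero =>
    simp only [zero_add, Finset.range_one, Finset.prod_singleton, add_zero, pow_zero, mul_one,
      Nat.descFactorial_zero, Nat.cast_one, one_div]
    exact inv_anti₀ hD (le_add_of_nonneg_right (by positivity))
  | succ d ih =>
    have ih' := ih fun x hx => hQ x (by omega)
    have hx := hQ (m + (d + 1)) le_rfl
    have hpos : 0 < D + μ₂ * ((m + (d + 1) : ℕ) : ℝ) := by positivity
    have hQ' : μ₂ * ((m + (d + 1) : ℕ) : ℝ) * (D + μ₂ * ((m + (d + 1) : ℕ) : ℝ))⁻¹ ≤ Q := by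
      rw [← div_eq_mul_inv, div_le_iff₀ hpos]; exact hx
    have hQ0 : 0 ≤ Q := le_trans (by positivity) hQ'
    have e : (m + (d + 1)).descFactorial (d + 1) = (m + (d + 1)) * (m + d).descFactorial d :=
      Nat.succ_descFactorial_succ (m + d) d
    rw [Finset.prod_range_succ, e]
    push_cast at hQ' ih' ⊢
    calc _ = (∏ l ∈ Finset.range (d + 1), (D + μ₂ * ((m : ℝ) + l))⁻¹ * 1) * μ₂ ^ d *
          ((m + d).descFactorial d : ℝ) *
          (μ₂ * ((m : ℝ) + (d + 1)) * (D + μ₂ * ((m : ℝ) + (d + 1)))⁻¹) := by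
            simp only [mul_one]; ring
      _ ≤ (Q ^ d / D) * Q := by
        simp only [mul_one]
        exact mul_le_mul ih' hQ' (by positivity) (by positivity)
      _ = _ := by ring

lemma Nwt_boundary_le {D Q c : ℝ} (h1 : 0 < μ₁) (h2 : 0 < μ₂) (hα : 0 < α)
    (hl : 0 < Nlam μ₁ μ₂ θ ρ n) (hn1 : 1 ≤ Npool1 θ n)
    (hsum : Npool1 θ n + Npool2 θ n = n)
    (hDdef : D = μ₁ * Npool1 θ n - (1 - α) * Nlam μ₁ μ₂ θ ρ n) (hD : 0 < D)
    (hG : 0 < μ₁ * (Npool1 θ n : ℝ) + μ₂ * (Npool2 θ n : ℝ) - Nlam μ₁ μ₂ θ ρ n)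
    (hQ0 : 0 ≤ Q)
    (hQ : ∀ x : ℕ, x ≤ Npool2 θ n → μ₂ * x ≤ Q * (D + μ₂ * x))
    (hc1 : 1 / D ≤ c)
    (hc2 : (D + μ₂ * Npool2 θ n) / (D *
      (μ₁ * (Npool1 θ n : ℝ) + μ₂ * (Npool2 θ n : ℝ) - Nlam μ₁ μ₂ θ ρ n)) ≤ c)
    {k i : ℕ} (hk : k ≤ Npool2 θ n) (hi : i ≤ k) :
    0 ≤ Nwt μ₁ μ₂ θ ρ α n (k, 0, i) ∧ Nwt μ₁ μ₂ θ ρ α n (k, 0, i) ≤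
      Npool1 θ n * μ₁ * (c * (((Npool2 θ n).descFactorial i : ℝ) *
        (μ₂ / (α * Nlam μ₁ μ₂ θ ρ n)) ^ i * Q ^ (k - i))) := by
  obtain ⟨d, hd⟩ := Nat.exists_eq_add_of_le hi
  obtain ⟨m, hm⟩ := Nat.exists_eq_add_of_le hk
  have key := prod_inv_mul_descFactorial_le (Q := Q) h2 hD m d fun x hx => hQ x (by omega)
  set lam := Nlam μ₁ μ₂ θ ρ n with hlam
  set n₁ := Npool1 θ n with hn₁
  set n₂ := Npool2 θ n with hn₂
  have hreindex : ∀ l : ℕ, (μ₁ * (n₁ : ℝ) + μ₂ * (((n - k + l : ℕ) : ℝ) - (n₁ : ℝ)) -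
      (1 - α) * lam)⁻¹ = (D + μ₂ * ((m + l : ℕ) : ℝ))⁻¹ := by
    intro l
    have : n - k + l = n₁ + (m + l) := by omega
    rw [this, hDdef]
    congr 1
    push_cast
    ring
  have hfac : (n₂.factorial : ℝ) / ((n₂ - k).factorial : ℝ) =
      (n₂.descFactorial i : ℝ) * ((m + d).descFactorial d : ℝ) := by
    have e1 := Nat.factorial_mul_descFactorial (n := n₂) (k := i) (by omega)
    have e2 := Nat.factorial_mul_descFactorial (n := m + d) (k := d) (by omega)
    have e3 : n₂ - i = m + d := by omega
    have e4 : m + d - d = n₂ - k := by omega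
    rw [e3] at e1
    rw [e4] at e2
    rw [div_eq_iff (by positivity), ← e1, ← e2]
    push_cast
    ring
  rcases Nat.eq_zero_or_pos i with h0 | hpos
  · subst h0
    have hval : Nwt μ₁ μ₂ θ ρ α n (k, 0, 0) = n₁ * μ₁ *
        ((∏ l ∈ Finset.range (d + 1), (D + μ₂ * ((m + l : ℕ) : ℝ))⁻¹) * μ₂ ^ d *
          (m + d).descFactorial d * ((D + μ₂ * n₂) *
            (μ₁ * (n₁ : ℝ) + μ₂ * (n₂ : ℝ) - lam)⁻¹)) := by
      simp only [Nwt]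
      rw [← hlam, ← hn₁, ← hn₂, if_neg (by omega), if_neg (by omega), if_pos ⟨hk, trivial, trivial⟩, hfac,
        Finset.prod_range_succ _ d]
      have : Finset.Icc (n - k) (n - 1) = Finset.Ico (n - k) (n - 1 + 1) := by
        ext; simp only [Finset.mem_Icc, Finset.mem_Ico]; omega
      rw [this, Finset.prod_Ico_eq_prod_range]
      simp only [hreindex]
      have e1 : n - 1 + 1 - (n - k) = d := by omega
      have e2 : k = d := by omega
      have e3 : m + d = n₂ := by omega
      rw [e1, e2, e3, Nat.descFactorial_zero]
      have : D + μ₂ * (n₂ : ℝ) ≠ 0 := by positivity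
      push_cast
      field_simp
    rw [hval]
    have hkd : k - 0 = d := by omega
    refine ⟨by positivity, ?_⟩
    refine mul_le_mul_of_nonneg_left ?_ (by positivity)
    rw [hkd, Nat.descFactorial_zero, pow_zero, Nat.cast_one, one_mul, one_mul]
    calc _ ≤ Q ^ d / D * ((D + μ₂ * n₂) * (μ₁ * (n₁ : ℝ) + μ₂ * (n₂ : ℝ) - lam)⁻¹) :=
          mul_le_mul_of_nonneg_right key (by positivity)
      _ = ((D + μ₂ * n₂) / (D * (μ₁ * (n₁ : ℝ) + μ₂ * (n₂ : ℝ) - lam))) * Q ^ d := by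
          field_simp
      _ ≤ _ := mul_le_mul_of_nonneg_right hc2 (by positivity)
  · have hval : Nwt μ₁ μ₂ θ ρ α n (k, 0, i) = n₁ * μ₁ *
        ((n₂.descFactorial i : ℝ) * (μ₂ / (α * lam)) ^ i *
        ((∏ l ∈ Finset.range (d + 1), (D + μ₂ * ((m + l : ℕ) : ℝ))⁻¹) * μ₂ ^ d *
          (m + d).descFactorial d)) := by
      simp only [Nwt]
      rw [← hlam, ← hn₁, ← hn₂, if_neg (by omega), if_pos ⟨by omega, hk, trivial, hpos, hi⟩, hfac]
      have : Finset.Icc (n - k) (n - i) = Finset.Ico (n - k) (n - i + 1) := by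
        ext; simp only [Finset.mem_Icc, Finset.mem_Ico]; omega
      rw [this, Finset.prod_Ico_eq_prod_range]
      simp only [hreindex]
      have e1 : n - i + 1 - (n - k) = d + 1 := by omega
      rw [e1, hd, pow_add, div_pow]
      ring
    rw [hval]
    have hkd : k - i = d := by omega
    refine ⟨by positivity, ?_⟩
    refine mul_le_mul_of_nonneg_left ?_ (by positivity)
    rw [hkd]
    have hle : Q ^ d / D ≤ c * Q ^ d := by
      calc _ = 1 / D * Q ^ d := by ring
        _ ≤ _ := mul_le_mul_of_nonneg_right hc1 (by positivity)
    calc _ ≤ (n₂.descFactorial i : ℝ) * (μ₂ / (α * lam)) ^ i * (c * Q ^ d) :=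
          mul_le_mul_of_nonneg_left (key.trans hle) (by positivity)
      _ = _ := by ring

lemma sum_boundary_Nwt {k : ℕ} (hk : k ≤ Npool2 θ n) :
    ∑ b ∈ Finset.range (Npool2 θ n + 1), Nwt μ₁ μ₂ θ ρ α n (k, 0, b) =
      ∑ b ∈ Finset.range (k + 1), Nwt μ₁ μ₂ θ ρ α n (k, 0, b) := by
  symm
  refine Finset.sum_subset (Finset.range_subset_range.2 (by omega)) fun b _ hb => ?_
  rw [Finset.mem_range] at hb
  simp only [Nwt]
  rw [if_neg (by omega), if_neg (by omega), if_neg (by omega)]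

end Levels

section Domination

variable {μ₁ μ₂ θ ρ α : ℝ} {n : ℕ}

lemma one_le_mul_nmom_inv_pow {lam : ℝ} (h1 : 0 < μ₁) (h2 : 0 < μ₂) (hl : 0 < lam) (N M k : ℕ)
    (hk : k ≤ M) : 1 ≤ lam * nmom μ₁ μ₂ lam N M (fun s => ((1 + μ₂ * s)⁻¹) ^ k) := by
  have hu := BddTest.inv h2
  have hv := BddTest.inv h1
  have a := nmom_pos (lam := lam) (N := N) (M := M) h1 h2 hl (hv.mul (hu.pow k)) fun s hs =>
    mul_pos (inv_one_add_mem h1 hs.le).1 (pow_pos (inv_one_add_mem h2 hs.le).1 k)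
  have b := nmom_pos (lam := lam) (N := N) (M := M) h1 h2 hl (hu.pow (k + 1)) fun s hs =>
    pow_pos (inv_one_add_mem h2 hs.le).1 (k + 1)
  rw [nmom_recursion h1 h2 hl k]
  have hk' : (0 : ℝ) ≤ M - k := sub_nonneg.2 (by exact_mod_cast hk)
  have e1 : 0 ≤ N * μ₁ *
    nmom μ₁ μ₂ lam N M (fun s => (1 + μ₁ * s)⁻¹ * ((1 + μ₂ * s)⁻¹) ^ k) := by positivity
  have e2 : 0 ≤ (M - k) * μ₂ * nmom μ₁ μ₂ lam N M (fun s => ((1 + μ₂ * s)⁻¹) ^ (k + 1)) := by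
    positivity
  linarith

/-- The level weights lie between the bulk part and the bulk part plus a small error. -/
lemma levelWt_sandwich {D Q c : ℝ} (h1 : 0 < μ₁) (h2 : 0 < μ₂) (hα : 0 < α)
    (hl : 0 < Nlam μ₁ μ₂ θ ρ n) (hn1 : 1 ≤ Npool1 θ n)
    (hsum : Npool1 θ n + Npool2 θ n = n)
    (hDdef : D = μ₁ * Npool1 θ n - (1 - α) * Nlam μ₁ μ₂ θ ρ n) (hD : 0 < D)
    (hG : 0 < μ₁ * (Npool1 θ n : ℝ) + μ₂ * (Npool2 θ n : ℝ) - Nlam μ₁ μ₂ θ ρ n)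
    (hQ0 : 0 ≤ Q)
    (hQ : ∀ x : ℕ, x ≤ Npool2 θ n → μ₂ * x ≤ Q * (D + μ₂ * x))
    (hc1 : 1 / D ≤ c)
    (hc2 : (D + μ₂ * Npool2 θ n) / (D *
      (μ₁ * (Npool1 θ n : ℝ) + μ₂ * (Npool2 θ n : ℝ) - Nlam μ₁ μ₂ θ ρ n)) ≤ c)
    {k : ℕ} (hk : k ≤ Npool2 θ n) :
    0 ≤ levelWt μ₁ μ₂ θ ρ α n k - Npool1 θ n * μ₁ * (((Npool2 θ n).descFactorial k : ℝ) *
      (μ₂ / (α * Nlam μ₁ μ₂ θ ρ n)) ^ k *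
      nmom μ₁ μ₂ (Nlam μ₁ μ₂ θ ρ n) (Npool1 θ n - 1) (Npool2 θ n)
        (fun s => ((1 + μ₂ * s)⁻¹) ^ k)) ∧
    levelWt μ₁ μ₂ θ ρ α n k - Npool1 θ n * μ₁ * (((Npool2 θ n).descFactorial k : ℝ) *
      (μ₂ / (α * Nlam μ₁ μ₂ θ ρ n)) ^ k *
      nmom μ₁ μ₂ (Nlam μ₁ μ₂ θ ρ n) (Npool1 θ n - 1) (Npool2 θ n)
        (fun s => ((1 + μ₂ * s)⁻¹) ^ k)) ≤
      Npool1 θ n * μ₁ * (c * ∑ i ∈ Finset.range (k + 1), (((Npool2 θ n).descFactorial i : ℝ) *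
        (μ₂ / (α * Nlam μ₁ μ₂ θ ρ n)) ^ i * Q ^ (k - i))) := by
  rw [levelWt_eq_sum, sum_bulk_Nwt h2 hα hl hn1 hk, add_sub_cancel_left, sum_boundary_Nwt hk,
    Finset.mul_sum, Finset.mul_sum]
  have h := fun i (hi : i ∈ Finset.range (k + 1)) =>
    Nwt_boundary_le h1 h2 hα hl hn1 hsum hDdef hD hG hQ0 hQ hc1 hc2 hk
      (Nat.lt_succ_iff.1 (Finset.mem_range.1 hi))
  exact ⟨Finset.sum_nonneg fun i hi => (h i hi).1, Finset.sum_le_sum fun i hi => (h i hi).2⟩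

lemma sum_ratio_le {lam Q : ℝ} (h1 : 0 < μ₁) (h2 : 0 < μ₂) (hl : 0 < lam) (hα : 0 < α)
    (hQ0 : 0 ≤ Q) (N M k : ℕ) (hk : k ≤ M)
    (hr : M * (μ₂ / (α * lam)) * (nmom μ₁ μ₂ lam N M (fun s => (1 + μ₂ * s)⁻¹) /
        nmom μ₁ μ₂ lam N M (fun _ => 1)) ≤ Q) :
    ∑ i ∈ Finset.range (k + 1), ((M.descFactorial i : ℝ) * (μ₂ / (α * lam)) ^ i * Q ^ (k - i)) ≤
      lam * ((k + 1) * Q ^ k) * nmom μ₁ μ₂ lam N M (fun _ => 1) := by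
  have hu := BddTest.inv h2
  have hJ : 0 < nmom μ₁ μ₂ lam N M (fun _ => 1) :=
    nmom_pos h1 h2 hl (BddTest.const 1) fun _ _ => one_pos
  have hU1 : 0 < nmom μ₁ μ₂ lam N M (fun s => (1 + μ₂ * s)⁻¹) :=
    nmom_pos h1 h2 hl hu fun s hs => (inv_one_add_mem h2 hs.le).1
  have hterm : ∀ i ∈ Finset.range (k + 1),
      (M.descFactorial i : ℝ) * (μ₂ / (α * lam)) ^ i * Q ^ (k - i) ≤
        lam * Q ^ k * nmom μ₁ μ₂ lam N M (fun _ => 1) := by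
    intro i hi
    have hi' : i ≤ k := Nat.lt_succ_iff.1 (Finset.mem_range.1 hi)
    have a := descFactorial_mul_nmom_le h1 h2 hl hα N M i
    have b := one_le_mul_nmom_inv_pow h1 h2 hl N M i (hi'.trans hk)
    have hpow := pow_le_pow_left₀ (by positivity) hr i
    have a' := a.trans (mul_le_mul_of_nonneg_right hpow hJ.le)
    have hP : 0 ≤ (M.descFactorial i : ℝ) * (μ₂ / (α * lam)) ^ i := by positivity
    have c1 := mul_le_mul_of_nonneg_left b hP
    have c2 := mul_le_mul_of_nonneg_left a' hl.le
    have c3 : (M.descFactorial i : ℝ) * (μ₂ / (α * lam)) ^ i ≤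
        lam * (Q ^ i * nmom μ₁ μ₂ lam N M (fun _ => 1)) := by linarith
    calc _ ≤ lam * (Q ^ i * nmom μ₁ μ₂ lam N M (fun _ => 1)) * Q ^ (k - i) :=
          mul_le_mul_of_nonneg_right c3 (by positivity)
      _ = lam * Q ^ (i + (k - i)) * nmom μ₁ μ₂ lam N M (fun _ => 1) := by rw [pow_add]; ring
      _ = _ := by rw [Nat.add_sub_cancel' hi']
  refine (Finset.sum_le_sum hterm).trans (le_of_eq ?_)
  simp only [Finset.sum_const, Finset.card_range, nsmul_eq_mul]
  push_cast
  ring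

end Domination

lemma tendsto_descFactorial_div_pow {M : ℕ → ℕ} {b : ℝ} (hb : 0 < b)
    (hM : Tendsto (fun n => (M n : ℝ) / n) atTop (nhds b)) (k : ℕ) :
    Tendsto (fun n : ℕ => ((M n).descFactorial k : ℝ) / (n : ℝ) ^ k) atTop (nhds (b ^ k)) := by
  induction k with
  | zero => simp
  | succ k ih =>
    have h0 : Tendsto (fun n : ℕ => (M n : ℝ) / n - k / n) atTop (nhds (b - 0)) :=
      hM.sub (tendsto_const_div_atTop_nhds_zero_nat (k : ℝ))
    rw [sub_zero] at h0
    have hev : ∀ᶠ n : ℕ in atTop, (0 : ℝ) < (M n : ℝ) / n - k / n := h0.eventually_const_lt hb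
    have := h0.mul ih
    rw [← pow_succ'] at this
    refine this.congr' ?_
    filter_upwards [hev, eventually_gt_atTop 0] with n hn hn0
    have hn' : (0 : ℝ) < n := by exact_mod_cast hn0
    have hk : k ≤ M n := by
      rw [← sub_div] at hn
      have := (div_pos_iff_of_pos_right hn').1 hn
      have : (k : ℝ) < M n := by linarith
      exact_mod_cast this.le
    rw [Nat.descFactorial_succ, Nat.cast_mul, Nat.cast_sub hk, pow_succ]
    field_simp

lemma tendsto_descFactorial_mul_pow {M : ℕ → ℕ} {lam : ℕ → ℝ} {b L κ α : ℝ} (hb : 0 < b)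
    (hL : 0 < L) (hα : 0 < α)
    (hM : Tendsto (fun n => (M n : ℝ) / n) atTop (nhds b))
    (hlam : Tendsto (fun n => lam n / n) atTop (nhds L)) (k : ℕ) :
    Tendsto (fun n : ℕ => ((M n).descFactorial k : ℝ) * (κ / (α * lam n)) ^ k) atTop
      (nhds ((b * (κ / (α * L))) ^ k)) := by
  have h1 := tendsto_descFactorial_div_pow hb hM k
  have h2 : Tendsto (fun n : ℕ => (κ / (α * (lam n / n))) ^ k) atTop
      (nhds ((κ / (α * L)) ^ k)) :=
    (tendsto_const_nhds.div (hlam.const_mul α) (by positivity)).pow k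
  have := h1.mul h2
  rw [← mul_pow] at this
  refine this.congr' ?_
  filter_upwards [eventually_gt_atTop 0] with n hn0
  have hn' : (n : ℝ) ≠ 0 := by exact_mod_cast hn0.ne'
  rw [div_mul_eq_mul_div, mul_div_assoc, ← div_pow]
  congr 2
  field_simp

lemma Npool1_add_Npool2 {θ : ℝ} (hθ : θ < 1) (n : ℕ) : Npool1 θ n + Npool2 θ n = n := by
  unfold Npool2
  have : Npool1 θ n ≤ n := by
    unfold Npool1
    refine Nat.ceil_le.2 ?_
    have : (0 : ℝ) ≤ n := n.cast_nonneg
    nlinarith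
  omega

lemma tendsto_Npool1 {θ : ℝ} (hθ : 0 ≤ θ) :
    Tendsto (fun n : ℕ => (Npool1 θ n : ℝ) / n) atTop (nhds θ) :=
  (tendsto_nat_ceil_mul_div_atTop hθ).comp tendsto_natCast_atTop_atTop

lemma tendsto_Npool2 {θ : ℝ} (hθ0 : 0 ≤ θ) (hθ : θ < 1) :
    Tendsto (fun n : ℕ => (Npool2 θ n : ℝ) / n) atTop (nhds (1 - θ)) := by
  refine ((tendsto_Npool1 hθ0).const_sub 1).congr' ?_
  filter_upwards [eventually_gt_atTop 0] with n hn0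
  have hn' : (n : ℝ) ≠ 0 := by exact_mod_cast hn0.ne'
  have : (Npool1 θ n : ℝ) + Npool2 θ n = n := by exact_mod_cast Npool1_add_Npool2 hθ n
  rw [eq_div_iff hn', sub_mul, div_mul_cancel₀ _ hn']
  linarith

lemma tendsto_Nlam {μ₁ μ₂ θ ρ : ℝ} (hθ0 : 0 ≤ θ) (hθ : θ < 1) :
    Tendsto (fun n : ℕ => Nlam μ₁ μ₂ θ ρ n / n) atTop
      (nhds (ρ * (θ * μ₁ + (1 - θ) * μ₂))) := by
  refine ((((tendsto_Npool1 hθ0).mul_const μ₁).add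
    ((tendsto_Npool2 hθ0 hθ).mul_const μ₂)).const_mul ρ).congr fun n => ?_
  unfold Nlam
  ring

/-- The geometric limit, in terms of the limiting drift `L`. -/
lemma NP_tendsto_geometric {μ₁ μ₂ θ ρ α T L r : ℝ} (h1 : 0 < μ₁) (h2 : 0 < μ₂)
    (hθ0 : 0 < θ) (hθ1 : θ < 1) (hα : 0 < α) (hT : 0 < T) (hL0 : 0 < L)
    (hLdef : L = ρ * (θ * μ₁ + (1 - θ) * μ₂)) (hL : L < θ * μ₁ + (1 - θ) * μ₂)
    (hroot : L = θ * μ₁ * (1 + μ₁ * T)⁻¹ + (1 - θ) * μ₂ * (1 + μ₂ * T)⁻¹)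
    (hδ : (1 - α) * L < θ * μ₁)
    (hrdef : r = (1 - θ) * (μ₂ / (α * L)) * (1 + μ₂ * T)⁻¹) (hr1 : r < 1) (k : ℕ) :
    Tendsto (fun n : ℕ => NP μ₁ μ₂ θ ρ α n {t : ℕ × ℕ × ℕ | t.1 = k})
      atTop (nhds ((1 - r) * r ^ k)) := by
  have hθ1' : 0 < 1 - θ := by linarith
  have hn1 := tendsto_Npool1 hθ0.le
  have hM := tendsto_Npool2 hθ0.le hθ1
  have hlam := tendsto_Nlam (μ₁ := μ₁) (μ₂ := μ₂) (ρ := ρ) hθ0.le hθ1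
  rw [← hLdef] at hlam
  have hnpos : ∀ᶠ n : ℕ in atTop, (0 : ℝ) < n := by
    filter_upwards [eventually_gt_atTop 0] with n hn
    exact_mod_cast hn
  have hlpos : ∀ᶠ n in atTop, 0 < Nlam μ₁ μ₂ θ ρ n := by
    filter_upwards [hlam.eventually_const_lt hL0, hnpos] with n hn hn0
    exact (div_pos_iff_of_pos_right hn0).1 hn
  have hn1pos : ∀ᶠ n in atTop, 1 ≤ Npool1 θ n := by
    filter_upwards [hn1.eventually_const_lt hθ0, hnpos] with n hn hn0
    have := (div_pos_iff_of_pos_right hn0).1 hn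
    exact_mod_cast this
  have hN : Tendsto (fun n : ℕ => ((Npool1 θ n - 1 : ℕ) : ℝ) / n) atTop (nhds θ) := by
    have h := hn1.sub (tendsto_const_div_atTop_nhds_zero_nat (1 : ℝ))
    rw [sub_zero] at h
    refine h.congr' ?_
    filter_upwards [hn1pos] with n hn
    rw [Nat.cast_sub hn, Nat.cast_one, sub_div]
  set lam : ℕ → ℝ := fun n => Nlam μ₁ μ₂ θ ρ n with hlamdef
  set J : ℕ → ℝ := fun n => nmom μ₁ μ₂ (lam n) (Npool1 θ n - 1) (Npool2 θ n) (fun _ => 1)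
    with hJdef
  set U : ℕ → ℕ → ℝ := fun n k =>
    nmom μ₁ μ₂ (lam n) (Npool1 θ n - 1) (Npool2 θ n) (fun s => ((1 + μ₂ * s)⁻¹) ^ k) with hUdef
  set P : ℕ → ℕ → ℝ := fun n k =>
    ((Npool2 θ n).descFactorial k : ℝ) * (μ₂ / (α * lam n)) ^ k with hPdef
  set D : ℕ → ℝ := fun n => μ₁ * Npool1 θ n - (1 - α) * lam n with hDdef
  set G : ℕ → ℝ := fun n => μ₁ * (Npool1 θ n : ℝ) + μ₂ * (Npool2 θ n : ℝ) - lam n with hGdef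
  set c : ℕ → ℝ := fun n => 1 / D n + (D n + μ₂ * Npool2 θ n) / (D n * G n) with hcdef
  have hJpos : ∀ᶠ n in atTop, 0 < J n := by
    filter_upwards [hlpos] with n hn
    exact nmom_pos h1 h2 hn (BddTest.const 1) fun _ _ => one_pos
  have hU : ∀ k, Tendsto (fun n => U n k / J n) atTop (nhds (((1 + μ₂ * T)⁻¹) ^ k)) := fun k =>
    tendsto_nmom_pow h1 h2 hθ0 hθ1 hT hN hM hlam hlpos hL hroot k
  have hJinv : Tendsto (fun n : ℕ => (n * J n)⁻¹) atTop (nhds 0) :=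
    tendsto_inv_mul_nmom h1 h2 hN hM hlam hlpos hL
  have hP : ∀ k, Tendsto (fun n => P n k) atTop (nhds (((1 - θ) * (μ₂ / (α * L))) ^ k)) := fun k =>
    tendsto_descFactorial_mul_pow hθ1' hL0 hα hM hlam k
  set d := μ₁ * θ - (1 - α) * L with hd
  have hdpos : 0 < d := by rw [hd]; linarith
  set g := μ₁ * θ + μ₂ * (1 - θ) - L with hg
  have hgpos : 0 < g := by rw [hg]; linarith
  have hDlim : Tendsto (fun n : ℕ => D n / n) atTop (nhds d) := by
    refine ((hn1.const_mul μ₁).sub (hlam.const_mul (1 - α))).congr fun n => ?_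
    rw [hDdef]; ring
  have hGlim : Tendsto (fun n : ℕ => G n / n) atTop (nhds g) := by
    refine (((hn1.const_mul μ₁).add (hM.const_mul μ₂)).sub hlam).congr fun n => ?_
    rw [hGdef]; ring
  have hDpos : ∀ᶠ n in atTop, 0 < D n := by
    filter_upwards [hDlim.eventually_const_lt hdpos, hnpos] with n hn hn0
    exact (div_pos_iff_of_pos_right hn0).1 hn
  have hGpos : ∀ᶠ n in atTop, 0 < G n := by
    filter_upwards [hGlim.eventually_const_lt hgpos, hnpos] with n hn hn0
    exact (div_pos_iff_of_pos_right hn0).1 hn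
  have hclim : Tendsto (fun n : ℕ => n * c n) atTop
      (nhds (1 / d + (d + μ₂ * (1 - θ)) / (d * g))) := by
    have a : Tendsto (fun n : ℕ => 1 / (D n / n)) atTop (nhds (1 / d)) :=
      tendsto_const_nhds.div hDlim hdpos.ne'
    have b := (hDlim.add (hM.const_mul μ₂)).div (hDlim.mul hGlim) (mul_pos hdpos hgpos).ne'
    refine (a.add b).congr' ?_
    filter_upwards [hDpos, hGpos, hnpos] with n x y z
    rw [hcdef]
    simp only [Pi.div_apply]
    field_simp
  set κ := 1 / d + (d + μ₂ * (1 - θ)) / (d * g)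
  have hclam : ∀ᶠ n in atTop, c n * lam n < κ * L + 1 := by
    have : Tendsto (fun n => c n * lam n) atTop (nhds (κ * L)) := by
      refine (hclim.mul hlam).congr' ?_
      filter_upwards [hnpos] with n z
      simp only [hlamdef]
      field_simp
    exact this.eventually_lt_const (by linarith)
  have hcJ : Tendsto (fun n => c n / J n) atTop (nhds 0) := by
    have := hclim.mul hJinv
    rw [mul_zero] at this
    refine this.congr' ?_
    filter_upwards [hnpos] with n z
    rw [mul_inv]; field_simp
  set q₀ := μ₂ * (1 - θ) / (d + μ₂ * (1 - θ)) with hq₀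
  have hμθ : 0 < μ₂ * (1 - θ) := mul_pos h2 hθ1'
  have hq₀0 : 0 < q₀ := by positivity
  have hq₀1 : q₀ < 1 := by rw [hq₀, div_lt_one (by positivity)]; linarith
  have hr0 : 0 < r := by rw [hrdef]; positivity
  obtain ⟨Q, hQm, hQ1⟩ := exists_between (max_lt hr1 hq₀1)
  have hQr : r < Q := (le_max_left _ _).trans_lt hQm
  have hQq : q₀ < Q := (le_max_right _ _).trans_lt hQm
  have hQ0 : 0 < Q := hr0.trans hQr
  have hratio : ∀ᶠ n in atTop, (Npool2 θ n : ℝ) * (μ₂ / (α * lam n)) *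
      (nmom μ₁ μ₂ (lam n) (Npool1 θ n - 1) (Npool2 θ n) (fun s => (1 + μ₂ * s)⁻¹) / J n) < Q := by
    have a := (hP 1).mul (hU 1)
    simp only [hPdef, hUdef, pow_one, Nat.descFactorial_one, ← hrdef] at a
    exact a.eventually_lt_const hQr
  have hQev : ∀ᶠ n in atTop, ∀ x : ℕ, x ≤ Npool2 θ n → μ₂ * x ≤ Q * (D n + μ₂ * x) := by
    have a : Tendsto (fun n => μ₂ * ((Npool2 θ n : ℝ) / n) /
        (D n / n + μ₂ * ((Npool2 θ n : ℝ) / n))) atTop (nhds q₀) :=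
      (hM.const_mul μ₂).div (hDlim.add (hM.const_mul μ₂)) (by positivity)
    filter_upwards [a.eventually_lt_const hQq, hDpos, hnpos] with n ha hD hn x hx
    have hx' : (x : ℝ) ≤ Npool2 θ n := by exact_mod_cast hx
    rw [div_lt_iff₀ (by positivity)] at ha
    have hb : μ₂ * (Npool2 θ n : ℝ) < Q * (D n + μ₂ * Npool2 θ n) := by
      have := mul_lt_mul_of_pos_right ha hn
      field_simp at this
      linarith
    have hxx := mul_le_mul_of_nonneg_left hx' (mul_nonneg (sub_nonneg.2 hQ1.le) h2.le)
    nlinarith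
  have hsand : ∀ᶠ n in atTop, ∀ k, k ≤ Npool2 θ n →
      0 ≤ levelWt μ₁ μ₂ θ ρ α n k / (Npool1 θ n * μ₁ * J n) - P n k * (U n k / J n) ∧
      levelWt μ₁ μ₂ θ ρ α n k / (Npool1 θ n * μ₁ * J n) - P n k * (U n k / J n) ≤
        c n / J n * ∑ i ∈ Finset.range (k + 1), P n i * Q ^ (k - i) := by
    filter_upwards [hlpos, hn1pos, hDpos, hGpos, hQev, hJpos] with n a1 a2 a3 a4 a5 a6 k hk
    have hb1 : 1 / D n ≤ c n := le_add_of_nonneg_right (by positivity)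
    have hb2 : (D n + μ₂ * Npool2 θ n) / (D n * G n) ≤ c n :=
      le_add_of_nonneg_left (by positivity)
    obtain ⟨s1, s2⟩ := levelWt_sandwich h1 h2 hα a1 a2 (Npool1_add_Npool2 hθ1 n) rfl a3 a4 hQ0.le
      a5 hb1 hb2 hk
    have hn1' : (0 : ℝ) < Npool1 θ n := by exact_mod_cast a2
    have hden : 0 < Npool1 θ n * μ₁ * J n := by positivity
    have e : levelWt μ₁ μ₂ θ ρ α n k / (Npool1 θ n * μ₁ * J n) - P n k * (U n k / J n) =
        (levelWt μ₁ μ₂ θ ρ α n k - Npool1 θ n * μ₁ * (P n k * U n k)) /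
          (Npool1 θ n * μ₁ * J n) := by
      field_simp
    rw [e]
    refine ⟨div_nonneg s1 hden.le, ?_⟩
    rw [div_le_iff₀ hden]
    refine s2.trans (le_of_eq ?_)
    have hJne : J n ≠ 0 := a6.ne'
    simp only [hPdef, hlamdef]
    field_simp
  have hMev : ∀ k : ℕ, ∀ᶠ n in atTop, k ≤ Npool2 θ n := by
    intro k
    have a : Tendsto (fun n : ℕ => (Npool2 θ n : ℝ) / n - k / n) atTop (nhds (1 - θ - 0)) :=
      hM.sub (tendsto_const_div_atTop_nhds_zero_nat (k : ℝ))
    rw [sub_zero] at a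
    filter_upwards [a.eventually_const_lt hθ1', hnpos] with n hn hn0
    rw [← sub_div] at hn
    have := (div_pos_iff_of_pos_right hn0).1 hn
    have : (k : ℝ) < Npool2 θ n := by linarith
    exact_mod_cast this.le
  have hlim : ∀ k, Tendsto (fun n => levelWt μ₁ μ₂ θ ρ α n k / (Npool1 θ n * μ₁ * J n)) atTop
      (nhds (r ^ k)) := by
    intro k
    have a := (hP k).mul (hU k)
    rw [← mul_pow, ← hrdef] at a
    have b : Tendsto (fun n => c n / J n * ∑ i ∈ Finset.range (k + 1), P n i * Q ^ (k - i)) atTop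
        (nhds 0) := by
      have := hcJ.mul (tendsto_finsetSum (Finset.range (k + 1)) fun i _ =>
        (hP i).mul_const (Q ^ (k - i)))
      rwa [zero_mul] at this
    have e : Tendsto (fun n => levelWt μ₁ μ₂ θ ρ α n k / (Npool1 θ n * μ₁ * J n) -
        P n k * (U n k / J n)) atTop (nhds 0) := by
      refine squeeze_zero' ?_ ?_ b
      · filter_upwards [hsand, hMev k] with n x y using (x k y).1
      · filter_upwards [hsand, hMev k] with n x y using (x k y).2
    have := e.add a
    simpa using this
  have hdom : ∀ᶠ n in atTop, ∀ k, ‖levelWt μ₁ μ₂ θ ρ α n k / (Npool1 θ n * μ₁ * J n)‖ ≤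
      Q ^ k + (κ * L + 1) * ((k + 1) * Q ^ k) := by
    filter_upwards [hsand, hlpos, hratio, hclam, hJpos, hDpos, hGpos] with n a1 a2 a3 a4 a5 a6 a7 k
    have hc0 : 0 ≤ c n := by
      simp only [hcdef]; positivity
    have hK : 0 ≤ κ * L + 1 := (mul_nonneg hc0 a2.le).trans a4.le
    rcases le_or_gt k (Npool2 θ n) with hk | hk
    · obtain ⟨s1, s2⟩ := a1 k hk
      have hPU : P n k * (U n k / J n) ≤ Q ^ k := by
        have a := descFactorial_mul_nmom_le h1 h2 a2 hα (Npool1 θ n - 1) (Npool2 θ n) k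
        have hpow := pow_le_pow_left₀ (mul_nonneg (by positivity) (div_nonneg
          (nmom_pos h1 h2 a2 (BddTest.inv h2) fun s hs => (inv_one_add_mem h2 hs.le).1).le
          a5.le)) a3.le k
        rw [mul_div_assoc', div_le_iff₀ a5]
        exact a.trans (mul_le_mul_of_nonneg_right hpow a5.le)
      have hPU0 : 0 ≤ P n k * (U n k / J n) := by
        refine mul_nonneg ?_ (div_nonneg (nmom_pos h1 h2 a2 ((BddTest.inv h2).pow k) fun s hs =>
          pow_pos (inv_one_add_mem h2 hs.le).1 k).le a5.le)
        simp only [hPdef]; positivity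
      have hsum : c n / J n * ∑ i ∈ Finset.range (k + 1), P n i * Q ^ (k - i) ≤
          (κ * L + 1) * ((k + 1) * Q ^ k) := by
        have h := sum_ratio_le h1 h2 a2 hα hQ0.le (Npool1 θ n - 1) (Npool2 θ n) k hk a3.le
        have h' := mul_le_mul_of_nonneg_left h (div_nonneg hc0 a5.le)
        refine h'.trans ?_
        calc _ = c n * lam n * ((k + 1) * Q ^ k) * (J n / J n) := by ring
          _ = c n * lam n * ((k + 1) * Q ^ k) := by rw [div_self a5.ne', mul_one]
          _ ≤ _ := mul_le_mul_of_nonneg_right a4.le (by positivity)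
      rw [Real.norm_eq_abs, abs_of_nonneg (by linarith)]
      linarith
    · rw [levelWt_eq_zero hk, zero_div, norm_zero]
      positivity
  have hsummable : Summable fun k : ℕ => Q ^ k + (κ * L + 1) * ((k + 1) * Q ^ k) := by
    have hnorm : ‖Q‖ < 1 := by rwa [Real.norm_eq_abs, abs_of_pos hQ0]
    have s0 := summable_geometric_of_lt_one hQ0.le hQ1
    have s1 := summable_pow_mul_geometric_of_norm_lt_one 1 hnorm
    refine s0.add (Summable.mul_left _ ((s1.add s0).congr fun k => ?_))
    rw [pow_one]; ring
  have htot := tendsto_tsum_of_dominated_convergence hsummable hlim hdom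
  rw [tsum_geometric_of_lt_one hr0.le hr1] at htot
  have hfin := (hlim k).div htot (inv_ne_zero (by linarith))
  rw [div_inv_eq_mul, mul_comm] at hfin
  refine hfin.congr' ?_
  filter_upwards [hJpos, hn1pos] with n a1 a2
  have hn1' : (0 : ℝ) < Npool1 θ n := by exact_mod_cast a2
  have hden : Npool1 θ n * μ₁ * J n ≠ 0 := by positivity
  simp only [Pi.div_apply]
  rw [NP_eq_levelWt, tsum_div_const, div_div_div_cancel_right₀ hden]

/-- Theorem 6 (geometric limit of `K`): under stability and complete resource
pooling, for each fixed `k` the stationary probability `P(K = k)` converges to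
`(1 - (1-β)/α)·((1-β)/α)^k`, i.e. `K` converges in distribution to a geometric
random variable on `{0,1,2,…}` with success probability `1 - (1-β)/α`. -/
theorem K_tendsto_geometric
    (μ₁ μ₂ θ ρ α T f₁ f₂ β δ : ℝ)
    (hμ₁ : 0 < μ₁) (hμ₂ : 0 < μ₂)
    (hθ : θ ∈ Set.Ioo (0 : ℝ) 1) (hρ : ρ ∈ Set.Ioo (0 : ℝ) 1)
    (hα : α ∈ Set.Ioc (0 : ℝ) 1)
    (hT : 0 < T)
    (hTroot : ρ * (θ * μ₁ + (1 - θ) * μ₂)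
        = θ * (1 / μ₁ + T)⁻¹ + (1 - θ) * (1 / μ₂ + T)⁻¹)
    (hf₁ : f₁ = T * θ / (T + 1 / μ₁))
    (hf₂ : f₂ = T * (1 - θ) / (T + 1 / μ₂))
    (hβ : β = f₁ / (f₁ + f₂))
    (hδ : δ = (1 - α) * ρ * (θ * μ₁ + (1 - θ) * μ₂) / (θ * μ₁))
    (hδ1 : δ < 1)
    (hpool : 1 < α + β) :
    ∀ k : ℕ,
      Tendsto (fun n : ℕ => NP μ₁ μ₂ θ ρ α n {t : ℕ × ℕ × ℕ | t.1 = k})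
        atTop (nhds ((1 - (1 - β) / α) * ((1 - β) / α) ^ k)) := by
  obtain ⟨hθ0, hθ1⟩ := hθ
  obtain ⟨hρ0, hρ1⟩ := hρ
  obtain ⟨hα0, hα1⟩ := hα
  intro k
  have hθ1' : 0 < 1 - θ := by linarith
  have hm : 0 < θ * μ₁ + (1 - θ) * μ₂ := by positivity
  have hv : ∀ {μ : ℝ}, 0 < μ → (1 / μ + T)⁻¹ = μ * (1 + μ * T)⁻¹ := by
    intro μ hμ
    have : 1 + μ * T ≠ 0 := by positivity
    field_simp
  have hroot : ρ * (θ * μ₁ + (1 - θ) * μ₂) =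
      θ * μ₁ * (1 + μ₁ * T)⁻¹ + (1 - θ) * μ₂ * (1 + μ₂ * T)⁻¹ := by
    rw [hTroot, hv hμ₁, hv hμ₂]; ring
  have hL0 : 0 < ρ * (θ * μ₁ + (1 - θ) * μ₂) := by positivity
  have hr : (1 - β) / α = (1 - θ) * (μ₂ / (α * (ρ * (θ * μ₁ + (1 - θ) * μ₂)))) *
      (1 + μ₂ * T)⁻¹ := by
    have e1 : f₁ = T * (θ * μ₁ * (1 + μ₁ * T)⁻¹) := by
      rw [hf₁, add_comm T, div_eq_mul_inv, hv hμ₁]; ring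
    have e2 : f₂ = T * ((1 - θ) * μ₂ * (1 + μ₂ * T)⁻¹) := by
      rw [hf₂, add_comm T, div_eq_mul_inv, hv hμ₂]; ring
    have e3 : f₁ + f₂ = T * (ρ * (θ * μ₁ + (1 - θ) * μ₂)) := by rw [e1, e2, hroot]; ring
    have e4 : f₁ + f₂ ≠ 0 := by rw [e3]; positivity
    have e5 : 1 - β = f₂ / (f₁ + f₂) := by rw [hβ]; field_simp; ring
    rw [e5, e3, e2]
    generalize ρ * (θ * μ₁ + (1 - θ) * μ₂) = L at hL0
    generalize (1 + μ₂ * T)⁻¹ = u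
    field_simp
  refine NP_tendsto_geometric hμ₁ hμ₂ hθ0 hθ1 hα0 hT hL0 rfl ?_ hroot ?_ hr ?_ k
  · exact mul_lt_of_lt_one_left hm hρ1
  · rw [hδ, div_lt_one (by positivity)] at hδ1
    linarith
  · rw [div_lt_one hα0]; linarith
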